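/- Let Γ be a countable group, S a finite symmetric generating set of Γ with 1 ∉ S, and μ an ergodic Γ-invariant percolation on Ω = (Γ × Γ → Bool) with μ(Ω₁) > 0 and with indistinguishable infinite clusters. Let λ = ∫_{Ω₁} δ_ω ⊗ P_ω dμ'(ω) be the path-bundle measure, and for ω ∈ Ω₁ let p_ω^{(n)}(1, y) = (κ_ω^{∘ n})(1)({y}) be the n-step transition probability of the simple random walk on C_ω(1). Then there exist constants l ≥ 0 and h ≥ 0 such that for λ-almost every (ω, (x_n)_n): lim_{n→∞} |x_n|/n = l and lim_{n→∞} −(1/n) log p_ω^{(n)}(1, x_n) = h, where |g| denotes the word length of g with respect to S. -/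

import Mathlib

open MeasureTheory Filter Topology
open scoped ENNReal

/-- The cluster of the identity in the percolation configuration `ω`. -/
def percCluster {Γ : Type*} [Group Γ] (S : Finset Γ) (ω : Γ × Γ → Bool) : Set Γ :=
  {g | Relation.ReflTransGen (fun x y : Γ => x⁻¹ * y ∈ S ∧ ω (x, y) = true) 1 g}

/-- The event that the cluster of the identity is infinite. -/
def percOmega1 {Γ : Type*} [Group Γ] (S : Finset Γ) : Set (Γ × Γ → Bool) :=
  {ω | (percCluster S ω).Infinite}

/-- The degree of `x` in the configuration `ω`. -/
def percDeg {Γ : Type*} [Group Γ] [DecidableEq Γ] (S : Finset Γ) (ω : Γ × Γ → Bool)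
    (x : Γ) : ℕ :=
  (S.filter (fun s => ω (x, x * s) = true)).card

/-- One-step transition probability of the simple random walk on the configuration `ω`. -/
noncomputable def percStep {Γ : Type*} [Group Γ] [DecidableEq Γ] (S : Finset Γ)
    (ω : Γ × Γ → Bool) (x z : Γ) : ℝ≥0∞ :=
  if 0 < percDeg S ω x then
    (if x⁻¹ * z ∈ S ∧ ω (x, z) = true then ((percDeg S ω x : ℝ≥0∞))⁻¹ else 0)
  else (if z = x then 1 else 0)

/-- The simple random walk kernel `κ_ω` on the configuration `ω`, as a measure-valued
map. -/
noncomputable def percKernel {Γ : Type*} [Group Γ] [DecidableEq Γ] [MeasurableSpace Γ]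
    (S : Finset Γ) (ω : Γ × Γ → Bool) (x : Γ) : Measure Γ :=
  if 0 < percDeg S ω x then
    ∑ s ∈ S.filter (fun s => ω (x, x * s) = true),
      ((percDeg S ω x : ℝ≥0∞))⁻¹ • Measure.dirac (x * s)
  else Measure.dirac x

/-- The `n`-fold composition `κ_ω^{∘n}` of the simple random walk kernel. -/
noncomputable def percIter {Γ : Type*} [Group Γ] [DecidableEq Γ] [MeasurableSpace Γ]
    (S : Finset Γ) (ω : Γ × Γ → Bool) : ℕ → Γ → Measure Γ
  | 0 => fun x => Measure.dirac x
  | (n + 1) => fun x => (percIter S ω n x).bind (percKernel S ω)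

/-- The word length of `g` with respect to the generating set `S`. -/
noncomputable def wordLength {Γ : Type*} [Group Γ] (S : Finset Γ) (g : Γ) : ℕ :=
  sInf {n : ℕ | ∃ L : List Γ, L.length = n ∧ (∀ a ∈ L, a ∈ S) ∧ L.prod = g}


lemma kg_decomp (A : ℕ → ℕ → ℝ) (b : ℕ → ℝ) (C θ : ℝ) (M : ℕ) (hC : 0 ≤ C) (hθ : 0 ≤ θ)
    (hb : ∀ k, 0 ≤ b k)
    (hz : ∀ k, A k 0 = 0) (h1 : ∀ k, A k 1 ≤ C)
    (hsub : ∀ k n m, A k (n + m) ≤ A k n + A (k + n) m)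
    (hB : ∀ k, 1 ≤ b k ∨ ∃ m, 1 ≤ m ∧ m ≤ M ∧ A k m ≤ m * θ) :
    ∀ n k, A k n ≤ n * θ + C * (∑ i ∈ Finset.range n, b (k + i)) + C * M := by
  have hlin : ∀ n k, A k n ≤ n * C := by
    intro n
    induction n with
    | zero => intro k; simp [hz]
    | succ n ih =>
      intro k
      have := hsub k n 1
      have h2 := ih k
      have h3 := h1 (k + n)
      push_cast
      linarith
  intro n
  induction n using Nat.strong_induction_on with
  | _ n ih =>
    intro k
    have hs : ∀ n k, 0 ≤ ∑ i ∈ Finset.range n, b (k + i) := fun n k =>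
      Finset.sum_nonneg fun i _ => hb _
    by_cases hn : n ≤ M
    · have h2 := hlin n k
      have h3 : (n : ℝ) * C ≤ C * M := by
        rw [mul_comm]; exact mul_le_mul_of_nonneg_left (by exact_mod_cast hn) hC
      have := mul_nonneg hC (hs n k)
      have : 0 ≤ (n : ℝ) * θ := by positivity
      linarith
    · push Not at hn
      rcases hB k with h | ⟨m, hm1, hmM, hm⟩
      · obtain ⟨n', rfl⟩ : ∃ n', n = n' + 1 := ⟨n - 1, by omega⟩
        have h2 := hsub k 1 n'
        have h3 := ih n' (by omega) (k + 1)
        have h4 := h1 k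
        rw [Finset.sum_range_succ']
        have h5 : ∑ i ∈ Finset.range n', b (k + 1 + i) = ∑ i ∈ Finset.range n', b (k + (i + 1)) :=
          Finset.sum_congr rfl fun i _ => by ring_nf
        rw [add_comm 1 n'] at h2
        rw [h5] at h3
        have h6 : C * 1 ≤ C * b k := mul_le_mul_of_nonneg_left h hC
        push_cast
        simp only [add_zero]
        nlinarith
      · obtain ⟨n', rfl⟩ : ∃ n', n = m + n' := ⟨n - m, by omega⟩
        have h2 := hsub k m n'
        have h3 := ih n' (by omega) (k + m)
        rw [Finset.sum_range_add]
        have h5 : ∑ i ∈ Finset.range n', b (k + m + i) = ∑ i ∈ Finset.range n', b (k + (m + i)) :=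
          Finset.sum_congr rfl fun i _ => by ring_nf
        rw [h5] at h3
        have h6 := mul_nonneg hC (hs m k)
        push_cast
        nlinarith

section Kingman

set_option linter.unusedSectionVars false

variable {X : Type*} [MeasurableSpace X] {ν : Measure X} [IsProbabilityMeasure ν] {T : X → X}

lemma kg_ae_orbit (hT : MeasurePreserving T ν ν) {p : X → Prop} (h : ∀ᵐ x ∂ν, p x) :
    ∀ᵐ x ∂ν, ∀ k, p (T^[k] x) := by
  rw [ae_all_iff]
  intro k
  exact (hT.iterate k).quasiMeasurePreserving.ae h

lemma kg_A (hT : Ergodic T ν) (a : ℕ → X → ℝ) (ham : ∀ n, Measurable (a n)) (C : ℝ)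
    (h0 : ∀ᵐ x ∂ν, ∀ n, 0 ≤ a n x) (hz : ∀ᵐ x ∂ν, a 0 x = 0) (h1 : ∀ᵐ x ∂ν, a 1 x ≤ C)
    (hsub : ∀ᵐ x ∂ν, ∀ n m, a (n + m) x ≤ a n x + a m (T^[n] x)) :
    ∃ l : ℝ, 0 ≤ l ∧ 0 ≤ C ∧ (∀ᵐ x ∂ν, ∀ r < l, ∀ᶠ n : ℕ in atTop, r < a n x / n) ∧
      ∀ ε > 0, ∀ δ > 0, ∃ B : Set X, ∃ M : ℕ, MeasurableSet B ∧ ν.real B < δ ∧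
        ∀ᵐ x ∂ν, ∀ n, a n x ≤ n * (l + ε) +
          C * (∑ i ∈ Finset.range n, B.indicator (fun _ => (1 : ℝ)) (T^[i] x)) + C * M := by
  have hTm := hT.toMeasurePreserving
  have hC : 0 ≤ C := by
    obtain ⟨x, hx, hx'⟩ := (h0.and h1).exists
    exact (hx 1).trans hx'
  have h0' := kg_ae_orbit hTm h0
  have hz' := kg_ae_orbit hTm hz
  have h1' := kg_ae_orbit hTm h1
  have hsub' := kg_ae_orbit hTm hsub
  have hlin : ∀ᵐ x ∂ν, ∀ n, a n x ≤ n * C := by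
    filter_upwards [hz, h1', hsub] with x hz h1 hsub n
    induction n with
    | zero => simp [hz]
    | succ n ih =>
      have := hsub n 1
      have h3 := h1 n
      push_cast
      linarith
  set u : ℕ → X → ℝ≥0∞ := fun n x => ENNReal.ofReal (a n x / n) with hu
  have hum : ∀ n, Measurable (u n) := fun n => ((ham n).div_const _).ennreal_ofReal
  set al : X → ℝ≥0∞ := fun x => liminf (fun n => u n x) atTop with hal
  have halm : Measurable al := Measurable.liminf hum
  have hub : ∀ᵐ x ∂ν, ∀ n, u n x ≤ ENNReal.ofReal C := by
    filter_upwards [hlin] with x hx n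
    apply ENNReal.ofReal_le_ofReal
    rcases Nat.eq_zero_or_pos n with rfl | hn
    · simpa using hC
    · rw [div_le_iff₀ (by positivity)]
      linarith [hx n]
  have halb : ∀ᵐ x ∂ν, al x ≤ ENNReal.ofReal C := by
    filter_upwards [hub] with x hx
    exact liminf_le_of_le (by isBoundedDefault) fun b hb => by
      obtain ⟨n, hn⟩ := hb.exists
      exact hn.trans (hx n)
  have hle : al ≤ᵐ[ν] al ∘ T := by
    filter_upwards [h0', h1, hsub] with x h0 h1 hsub
    have e1 : al x = liminf (fun n => u (n + 1) x) atTop := (liminf_nat_add (fun n => u n x) 1).symm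
    have e2 : al (T x) = liminf ((fun n => u n (T x)) +
        fun n : ℕ => ENNReal.ofReal (C * (1 / ((n : ℝ) + 1)))) atTop := by
      rw [ENNReal.liminf_add_of_right_tendsto_zero]
      have := (tendsto_one_div_add_atTop_nhds_zero_nat (𝕜 := ℝ)).const_mul C
      rw [mul_zero] at this
      simpa using ENNReal.tendsto_ofReal this
    simp only [Function.comp]
    rw [e1, e2]
    refine liminf_le_liminf ?_ (by isBoundedDefault) (by isBoundedDefault)
    filter_upwards [eventually_ge_atTop 1] with n hn
    simp only [hu, Pi.add_apply]
    have hn' : (0 : ℝ) < n := by exact_mod_cast hn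
    have h4 : 0 ≤ a n (T x) := by simpa using h0 1 n
    rw [← ENNReal.ofReal_add (by positivity) (by positivity)]
    apply ENNReal.ofReal_le_ofReal
    have h2 := hsub 1 n
    rw [add_comm 1 n] at h2
    simp only [Function.iterate_one] at h2
    calc a (n + 1) x / ((n + 1 : ℕ) : ℝ) ≤ (C + a n (T x)) / ((n : ℝ) + 1) := by
          push_cast
          gcongr
          linarith
      _ = a n (T x) / ((n : ℝ) + 1) + C * (1 / ((n : ℝ) + 1)) := by ring
      _ ≤ _ := by gcongr; linarith
  have hfin : ∫⁻ x, al x ∂ν ≠ ∞ := by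
    have : ∫⁻ x, al x ∂ν ≤ ∫⁻ x, ENNReal.ofReal C ∂ν := lintegral_mono_ae halb
    refine ne_top_of_le_ne_top ?_ this
    simp
  have heq : al =ᵐ[ν] al ∘ T := ae_eq_of_ae_le_of_lintegral_le hle hfin
    (halm.comp hTm.measurable).aemeasurable (hTm.lintegral_comp halm).le
  obtain ⟨c, hc⟩ := hT.ae_eq_const_of_ae_eq_comp₀ halm.nullMeasurable heq.symm
  have hcC : c ≤ ENNReal.ofReal C := by
    obtain ⟨x, hx, hx'⟩ := (hc.and halb).exists
    simpa [hx] using hx'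
  have hctop : c ≠ ∞ := ne_top_of_le_ne_top ENNReal.ofReal_ne_top hcC
  refine ⟨c.toReal, ENNReal.toReal_nonneg, hC, ?_, ?_⟩
  · filter_upwards [hc, h0] with x hx h0 r hr
    rcases lt_or_ge r 0 with hr0 | hr0
    · filter_upwards with n
      exact hr0.trans_le (div_nonneg (h0 n) (Nat.cast_nonneg n))
    have : ENNReal.ofReal r < liminf (fun n => u n x) atTop := by
      have : al x = c := hx
      rw [show liminf (fun n => u n x) atTop = c from this]
      exact (ENNReal.ofReal_lt_iff_lt_toReal hr0 hctop).2 hr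
    filter_upwards [eventually_lt_of_lt_liminf this] with n hn
    exact (ENNReal.ofReal_lt_ofReal_iff_of_nonneg hr0).1 hn
  · intro ε hε δ hδ
    set θ := c.toReal + ε with hθ
    have hθ0 : 0 < θ := by positivity
    set B : ℕ → Set X := fun M => {x | ∀ m, 1 ≤ m → m ≤ M → m * θ < a m x} with hBdef
    have hBm : ∀ M, MeasurableSet (B M) := by
      intro M
      simp only [hBdef, Set.ofPred_forall]
      refine MeasurableSet.iInter fun m => MeasurableSet.iInter fun _ => MeasurableSet.iInter fun _ => ?_
      exact measurableSet_lt measurable_const (ham m)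
    have hanti : Antitone B := fun M M' hM x hx m h1 h2 => hx m h1 (h2.trans hM)
    have hnull : ν (⋂ M, B M) = 0 := by
      rw [measure_eq_zero_iff_ae_notMem]
      filter_upwards [hc] with x hx hmem
      have h2 : liminf (fun n => u n x) atTop < ENNReal.ofReal θ := by
        have : al x = c := hx
        rw [show liminf (fun n => u n x) atTop = c from this]
        rw [ENNReal.lt_ofReal_iff_toReal_lt hctop]
        linarith
      obtain ⟨n, hn, hn1⟩ := ((frequently_lt_of_liminf_lt (by isBoundedDefault) h2).and_eventually
        (eventually_ge_atTop 1)).exists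
      have h3 := Set.mem_iInter.1 hmem n n hn1 le_rfl
      have h4 := (ENNReal.ofReal_lt_ofReal_iff hθ0).1 hn
      rw [div_lt_iff₀ (by positivity)] at h4
      linarith
    have htend := tendsto_measure_iInter_atTop (μ := ν) (fun M => (hBm M).nullMeasurableSet) hanti
      ⟨0, measure_ne_top _ _⟩
    rw [hnull] at htend
    obtain ⟨M, hM⟩ := (htend.eventually_lt_const
      (show (0 : ℝ≥0∞) < ENNReal.ofReal δ by simpa using hδ)).exists
    refine ⟨B M, M, hBm M, ?_, ?_⟩
    · rw [measureReal_def]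
      exact (ENNReal.lt_ofReal_iff_toReal_lt (measure_ne_top _ _)).1 hM
    · filter_upwards [hz', h1', hsub'] with x hz h1 hsub n
      have := kg_decomp (fun k n => a n (T^[k] x))
        (fun k => (B M).indicator (fun _ => (1 : ℝ)) (T^[k] x)) C θ M hC hθ0.le
        (fun k => Set.indicator_nonneg (fun _ _ => zero_le_one) _) hz h1
        (fun k n m => by
          have := hsub k n m
          rwa [← Function.iterate_add_apply, add_comm n k] at this)
        (fun k => by
          by_cases hk : T^[k] x ∈ B M
          · left; simp [hk]
          · right
            simp only [hBdef, Set.mem_ofPred_eq] at hk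
            push Not at hk
            obtain ⟨m, h1, h2, h3⟩ := hk
            exact ⟨m, h1, h2, h3⟩) n 0
      simpa using this

lemma kg_int (hT : Ergodic T ν) (f : X → ℝ) (hf : Measurable f) (C : ℝ)
    (h0 : ∀ x, 0 ≤ f x) (h1 : ∀ x, f x ≤ C) :
    ∀ᵐ x ∂ν, ∀ r < ∫ x, f x ∂ν, ∀ᶠ n : ℕ in atTop, r < birkhoffSum T f n x / n := by
  have hTm := hT.toMeasurePreserving
  have hmeas : ∀ n (g : X → ℝ), Measurable g → Measurable (birkhoffSum T g n) := by
    intro n g hg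
    unfold birkhoffSum
    exact Finset.measurable_sum _ fun i _ => hg.comp (hTm.measurable.iterate i)
  have hint : ∀ i (g : X → ℝ), Measurable g → ∫ x, g (T^[i] x) ∂ν = ∫ x, g x ∂ν := by
    intro i g hg
    have := (hTm.iterate i).map_eq
    conv_rhs => rw [← this]
    rw [integral_map (hTm.iterate i).measurable.aemeasurable hg.aestronglyMeasurable]
  obtain ⟨l, hl, hC, hlow, hup⟩ := kg_A hT (fun n => birkhoffSum T f n) (fun n => hmeas n f hf) C
    (ae_of_all _ fun x n => Finset.sum_nonneg fun i _ => h0 _)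
    (ae_of_all _ fun x => by simp) (ae_of_all _ fun x => by simpa using h1 x)
    (ae_of_all _ fun x n m => (birkhoffSum_add T f n m x).le)
  have hbd : ∀ (g : X → ℝ) (K : ℝ) , Measurable g → (∀ x, 0 ≤ g x) → (∀ x, g x ≤ K) →
      ∀ i, Integrable (fun x => g (T^[i] x)) ν := by
    intro g K hg h h' i
    refine Integrable.of_bound (hg.comp (hTm.measurable.iterate i)).aestronglyMeasurable K ?_
    exact ae_of_all _ fun x => by rw [Real.norm_of_nonneg (h _)]; exact h' _
  have key : ∫ x, f x ∂ν ≤ l := by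
    apply le_of_forall_pos_le_add
    intro ε hε
    obtain ⟨B, M, hB, hBδ, hBn⟩ := hup (ε / 3) (by positivity) (ε / 3 / (C + 1)) (by positivity)
    set I := ∫ x, f x ∂ν
    have hbm : Measurable (B.indicator (fun _ => (1 : ℝ))) := measurable_const.indicator hB
    have hb0 : ∀ x, 0 ≤ B.indicator (fun _ => (1 : ℝ)) x := fun x =>
      Set.indicator_nonneg (fun _ _ => zero_le_one) _
    have hb1 : ∀ x, B.indicator (fun _ => (1 : ℝ)) x ≤ 1 := fun x =>
      Set.indicator_le_self' (fun _ _ => zero_le_one) x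
    have hbi : ∫ x, B.indicator (fun _ => (1 : ℝ)) x ∂ν = ν.real B := by
      rw [integral_indicator hB]; simp
    have hn : ∀ n : ℕ, n * I ≤ n * (l + ε / 3) + C * (n * ν.real B) + C * M := by
      intro n
      have e1 : ∫ x, birkhoffSum T f n x ∂ν = n * I := by
        unfold birkhoffSum
        rw [integral_finsetSum _ fun i _ => hbd f C hf h0 h1 i]
        simp [hint _ f hf, I]
      have e2 : ∫ x, (∑ i ∈ Finset.range n, B.indicator (fun _ => (1 : ℝ)) (T^[i] x)) ∂ν
          = n * ν.real B := by
        rw [integral_finsetSum _ fun i _ => hbd _ 1 hbm hb0 hb1 i]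
        simp only [hint _ _ hbm, hbi]
        simp
      have i2 : Integrable (fun x => ∑ i ∈ Finset.range n, B.indicator (fun _ => (1 : ℝ)) (T^[i] x)) ν :=
        integrable_finsetSum _ fun i _ => hbd _ 1 hbm hb0 hb1 i
      have i1 : Integrable (birkhoffSum T f n) ν :=
        integrable_finsetSum _ fun i _ => hbd f C hf h0 h1 i
      rw [← e1, ← e2]
      calc _ ≤ ∫ x, (n * (l + ε / 3) +
          C * (∑ i ∈ Finset.range n, B.indicator (fun _ => (1 : ℝ)) (T^[i] x)) + C * M) ∂ν :=
            integral_mono_ae i1 (((integrable_const _).add (i2.const_mul C)).add (integrable_const _))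
              (by filter_upwards [hBn] with x hx using hx n)
        _ = _ := by
          have i3 : Integrable (fun x => n * (l + ε / 3) +
            C * (∑ i ∈ Finset.range n, B.indicator (fun _ => (1 : ℝ)) (T^[i] x))) ν :=
            (integrable_const _).add (i2.const_mul C)
          rw [integral_add i3 (integrable_const _),
            integral_add (integrable_const _) (i2.const_mul C), integral_const_mul C]
          simp
    obtain ⟨n, hn0⟩ := exists_nat_gt (C * M / (ε / 3))
    have hn1 := hn n
    rw [div_lt_iff₀ (by positivity)] at hn0
    have hnpos : (0 : ℝ) < n := by
      have : 0 ≤ C * M := by positivity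
      by_contra h
      push Not at h
      nlinarith
    have hCB : C * ν.real B ≤ ε / 3 := by
      rw [lt_div_iff₀ (by positivity)] at hBδ
      nlinarith [measureReal_nonneg (μ := ν) (s := B)]
    have : n * I ≤ n * (l + ε) := by nlinarith
    exact le_of_mul_le_mul_left this hnpos
  filter_upwards [hlow] with x hx r hr
  exact hx r (hr.trans_le key)

theorem kg_main (hT : Ergodic T ν) (a : ℕ → X → ℝ) (ham : ∀ n, Measurable (a n)) (C : ℝ)
    (h0 : ∀ᵐ x ∂ν, ∀ n, 0 ≤ a n x) (hz : ∀ᵐ x ∂ν, a 0 x = 0) (h1 : ∀ᵐ x ∂ν, a 1 x ≤ C)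
    (hsub : ∀ᵐ x ∂ν, ∀ n m, a (n + m) x ≤ a n x + a m (T^[n] x)) :
    ∃ l : ℝ, 0 ≤ l ∧ ∀ᵐ x ∂ν, Tendsto (fun n : ℕ => a n x / n) atTop (𝓝 l) := by
  obtain ⟨l, hl, hC, hlow, hup⟩ := kg_A hT a ham C h0 hz h1 hsub
  refine ⟨l, hl, ?_⟩
  have hkey : ∀ k : ℕ, ∀ᵐ x ∂ν, ∀ᶠ n : ℕ in atTop, a n x / n < l + 1 / ((k : ℝ) + 1) := by
    intro k
    set ε : ℝ := 1 / ((k : ℝ) + 1) with hεd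
    have hε : 0 < ε := by positivity
    obtain ⟨B, M, hB, hBδ, hBn⟩ := hup (ε / 4) (by positivity) (ε / 4 / (C + 1)) (by positivity)
    have hbm : Measurable (B.indicator (fun _ => (1 : ℝ))) := measurable_const.indicator hB
    have hb0 : ∀ x, 0 ≤ B.indicator (fun _ => (1 : ℝ)) x := fun x =>
      Set.indicator_nonneg (fun _ _ => zero_le_one) _
    have hb1 : ∀ x, B.indicator (fun _ => (1 : ℝ)) x ≤ 1 := fun x =>
      Set.indicator_le_self' (fun _ _ => zero_le_one) x
    have hbi : ∫ x, B.indicator (fun _ => (1 : ℝ)) x ∂ν = ν.real B := by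
      rw [integral_indicator hB]; simp
    have hk := kg_int hT (fun x => 1 - B.indicator (fun _ => (1 : ℝ)) x) (measurable_const.sub hbm) 1
      (fun x => by linarith [hb1 x]) (fun x => by linarith [hb0 x])
    have hbint : Integrable (B.indicator (fun _ => (1 : ℝ))) ν := (integrable_const _).indicator hB
    rw [integral_sub (integrable_const _) hbint, hbi] at hk
    simp only [integral_const, probReal_univ, smul_eq_mul, mul_one] at hk
    filter_upwards [hk, hBn] with x hx hBn
    have h2 := hx (1 - ε / 4 / (C + 1)) (by linarith)
    obtain ⟨N, hN⟩ := exists_nat_gt (C * M / (ε / 4))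
    filter_upwards [h2, eventually_ge_atTop (max 1 N)] with n hn hn'
    have hn1 : (0 : ℝ) < n := by
      have : 1 ≤ n := (le_max_left _ _).trans hn'
      exact_mod_cast this
    have hnN : (N : ℝ) ≤ n := by exact_mod_cast (le_max_right _ _).trans hn'
    have h3 := hBn n
    rw [lt_div_iff₀ hn1] at hn
    rw [div_lt_iff₀ hn1]
    simp only [birkhoffSum, Finset.sum_sub_distrib, Finset.sum_const, Finset.card_range,
      nsmul_eq_mul, mul_one] at hn
    set Sg := ∑ i ∈ Finset.range n, B.indicator (fun _ => (1 : ℝ)) (T^[i] x)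
    have h4 : Sg < ε / 4 / (C + 1) * n := by linarith
    have h5 : C * M < n * (ε / 4) := by
      rw [div_lt_iff₀ (by positivity)] at hN
      nlinarith
    have h6 : C * Sg ≤ ε / 4 * n := by
      have h7 : C * Sg ≤ C * (ε / 4 / (C + 1) * n) := mul_le_mul_of_nonneg_left h4.le hC
      have h8 : C * (ε / 4 / (C + 1) * n) = C / (C + 1) * (ε / 4 * n) := by ring
      have h9 : C / (C + 1) ≤ 1 := by rw [div_le_one (by positivity)]; linarith
      have h10 : 0 ≤ ε / 4 * n := by positivity
      nlinarith
    nlinarith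
  rw [← ae_all_iff] at hkey
  filter_upwards [hlow, hkey] with x hx hx'
  rw [tendsto_order]
  refine ⟨hx, fun r hr => ?_⟩
  obtain ⟨k, hk⟩ := exists_nat_one_div_lt (show 0 < r - l by linarith)
  filter_upwards [hx' k] with n hn
  linarith

end Kingman

section Perc

set_option linter.unusedSectionVars false
set_option linter.unusedVariables false

variable {Γ : Type*} [Group Γ] [Countable Γ] [DecidableEq Γ]
    [MeasurableSpace Γ] [MeasurableSingletonClass Γ] {S : Finset Γ}

/-- translation of a configuration -/
def ptr (g : Γ) (ω : Γ × Γ → Bool) : Γ × Γ → Bool := fun p => ω (g * p.1, g * p.2)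

lemma ptr_ptr (g h : Γ) (ω : Γ × Γ → Bool) : ptr h (ptr g ω) = ptr (g * h) ω := by
  funext p; simp [ptr, mul_assoc]

lemma ptr_one (ω : Γ × Γ → Bool) : ptr 1 ω = ω := by
  funext p; simp [ptr]

lemma measurable_ptr (g : Γ) : Measurable (ptr g : (Γ × Γ → Bool) → _) :=
  measurable_pi_lambda _ fun p => measurable_pi_apply _

lemma percDeg_ptr (g x : Γ) (ω : Γ × Γ → Bool) : percDeg S (ptr g ω) x = percDeg S ω (g * x) := by
  unfold percDeg
  congr 1
  ext s
  simp only [Finset.mem_filter]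
  simp [ptr, mul_assoc]

lemma percStep_ptr (g x y : Γ) (ω : Γ × Γ → Bool) :
    percStep S (ptr g ω) x y = percStep S ω (g * x) (g * y) := by
  have h1 : (x⁻¹ * y ∈ S ∧ ptr g ω (x, y) = true) ↔
      ((g * x)⁻¹ * (g * y) ∈ S ∧ ω (g * x, g * y) = true) := by
    simp [ptr, mul_assoc]
  have h2 : g * y = g * x ↔ y = x := mul_right_inj g
  unfold percStep
  simp only [percDeg_ptr, h1, h2]

/-- the adjacency relation -/
def pR (S : Finset Γ) (ω : Γ × Γ → Bool) (x y : Γ) : Prop := x⁻¹ * y ∈ S ∧ ω (x, y) = true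

/-- symmetric configurations -/
def pSym (ω : Γ × Γ → Bool) : Prop := ∀ x y : Γ, ω (x, y) = ω (y, x)

lemma pSym_ptr {ω : Γ × Γ → Bool} (h : pSym ω) (g : Γ) : pSym (ptr g ω) := fun x y => h _ _

lemma pR_symm (hS : ∀ s ∈ S, s⁻¹ ∈ S) {ω : Γ × Γ → Bool} (h : pSym ω) :
    Std.Symm (pR S ω) := ⟨fun x y hxy => ⟨by simpa using hS _ hxy.1, by rw [h]; exact hxy.2⟩⟩

lemma mem_percCluster {ω : Γ × Γ → Bool} {g : Γ} :
    g ∈ percCluster S ω ↔ Relation.ReflTransGen (pR S ω) 1 g := Iff.rfl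

lemma pR_ptr (g x y : Γ) (ω : Γ × Γ → Bool) : pR S (ptr g ω) x y ↔ pR S ω (g * x) (g * y) := by
  simp [pR, ptr, mul_assoc]

lemma pRT_ptr (g x y : Γ) (ω : Γ × Γ → Bool) :
    Relation.ReflTransGen (pR S (ptr g ω)) x y ↔
      Relation.ReflTransGen (pR S ω) (g * x) (g * y) := by
  constructor
  · intro h
    exact Relation.ReflTransGen.lift (fun z => g * z) (fun a b hab => (pR_ptr g a b ω).1 hab) _ _ h
  · intro h
    have := Relation.ReflTransGen.lift (p := pR S (ptr g ω)) (fun z => g⁻¹ * z)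
      (fun a b hab => (pR_ptr g _ _ ω).2 (by simpa using hab)) _ _ h
    simpa [Function.onFun] using this

lemma cluster_ptr (hS : ∀ s ∈ S, s⁻¹ ∈ S) {ω : Γ × Γ → Bool} (h : pSym ω) {g : Γ}
    (hg : g ∈ percCluster S ω) :
    percCluster S (ptr g ω) = (fun x => g * x) ⁻¹' percCluster S ω := by
  ext x
  rw [Set.mem_preimage, mem_percCluster, mem_percCluster, pRT_ptr, mul_one]
  rw [mem_percCluster] at hg
  have := pR_symm hS h
  exact ⟨fun h' => hg.trans h', fun h' => (Relation.ReflTransGen.stdSymm.symm _ _ hg).trans h'⟩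

lemma omega1_ptr (hS : ∀ s ∈ S, s⁻¹ ∈ S) {ω : Γ × Γ → Bool} (h : pSym ω) {g : Γ}
    (hg : g ∈ percCluster S ω) : ptr g ω ∈ percOmega1 S ↔ ω ∈ percOmega1 S := by
  change (percCluster S (ptr g ω)).Infinite ↔ (percCluster S ω).Infinite
  rw [cluster_ptr hS h hg]
  have h1 : (fun x => g * x) ⁻¹' percCluster S ω = (Equiv.mulLeft g).symm '' percCluster S ω := by
    rw [Equiv.image_symm_eq_preimage]; rfl
  rw [h1, Set.infinite_image_iff (Equiv.injective _).injOn]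

lemma omega1_deg_pos {ω : Γ × Γ → Bool} (h : ω ∈ percOmega1 S) : 0 < percDeg S ω 1 := by
  obtain ⟨g, hg, hg1⟩ := Set.Infinite.exists_notMem_finset h {1}
  rw [mem_percCluster] at hg
  rcases Relation.ReflTransGen.cases_head hg with h1 | ⟨s, hs, _⟩
  · simp [← h1] at hg1
  · simp only [pR, inv_one, one_mul] at hs
    apply Finset.card_pos.2
    exact ⟨s, by simpa using hs⟩

lemma measurableSet_pR (x y : Γ) : MeasurableSet {ω : Γ × Γ → Bool | pR S ω x y} := by
  have : {ω : Γ × Γ → Bool | pR S ω x y} = {ω | x⁻¹ * y ∈ S} ∩ (fun ω => ω (x, y)) ⁻¹' {true} := by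
    ext ω; simp [pR]
  rw [this]
  exact (MeasurableSet.const _).inter (measurable_pi_apply (x, y) (MeasurableSet.singleton _))

lemma measurableSet_mem_cluster (g : Γ) :
    MeasurableSet {ω : Γ × Γ → Bool | g ∈ percCluster S ω} := by
  let U : ℕ → Γ → Set (Γ × Γ → Bool) := fun n => Nat.rec (fun g => {_ω | g = 1})
    (fun _ V g => ⋃ h, (V h ∩ {ω | pR S ω h g})) n
  have hU : ∀ n g, MeasurableSet (U n g) := by
    intro n
    induction n with
    | zero => intro g; exact MeasurableSet.const _
    | succ n ih => intro g; exact MeasurableSet.iUnion fun h => (ih h).inter (measurableSet_pR _ _)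
  have : {ω : Γ × Γ → Bool | g ∈ percCluster S ω} = ⋃ n, U n g := by
    ext ω
    simp only [Set.mem_iUnion]
    constructor
    · intro h'
      have h : Relation.ReflTransGen (pR S ω) 1 g := h'
      clear h'
      induction h with
      | refl => exact ⟨0, rfl⟩
      | tail _ hbc ih =>
        obtain ⟨n, hn⟩ := ih
        exact ⟨n + 1, Set.mem_iUnion.2 ⟨_, hn, hbc⟩⟩
    · rintro ⟨n, hn⟩
      change Relation.ReflTransGen (pR S ω) 1 g
      induction n generalizing g with
      | zero =>
        have : g = 1 := hn
        rw [this]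
      | succ n ih =>
        obtain ⟨h, hh, hR⟩ := Set.mem_iUnion.1 hn
        exact (ih h hh).tail hR
  rw [this]
  exact MeasurableSet.iUnion fun n => hU n g

lemma measurableSet_omega1 : MeasurableSet (percOmega1 S : Set (Γ × Γ → Bool)) := by
  have : (percOmega1 S : Set (Γ × Γ → Bool)) = ⋂ F : Finset Γ, ⋃ g : Γ, ⋃ _ : g ∉ F,
      {ω : Γ × Γ → Bool | g ∈ percCluster S ω} := by
    ext ω
    simp only [Set.mem_iInter, Set.mem_iUnion]
    constructor
    · intro h F
      obtain ⟨g, hg, hgF⟩ := Set.Infinite.exists_notMem_finset h F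
      exact ⟨g, hgF, hg⟩
    · intro h hfin
      obtain ⟨g, hg, hg'⟩ := h hfin.toFinset
      exact hg (by simpa using hg')
  rw [this]
  exact MeasurableSet.iInter fun F => MeasurableSet.iUnion fun g => MeasurableSet.iUnion fun _ =>
    measurableSet_mem_cluster g

lemma measurable_deg (x : Γ) : Measurable (fun ω : Γ × Γ → Bool => percDeg S ω x) := by
  simp only [percDeg, Finset.card_filter]
  refine Finset.measurable_sum _ fun s _ => ?_
  exact Measurable.ite (measurableSet_eq_fun (measurable_pi_apply (x, x * s)) measurable_const)
    measurable_const measurable_const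

lemma measurable_step (x y : Γ) : Measurable (fun ω : Γ × Γ → Bool => percStep S ω x y) := by
  unfold percStep
  refine Measurable.ite ?_ (Measurable.ite (measurableSet_pR x y) ?_ measurable_const)
    measurable_const
  · exact measurableSet_lt measurable_const (measurable_deg x)
  · exact ((measurable_from_top (f := fun n : ℕ => (n : ℝ≥0∞))).comp (measurable_deg x)).inv

lemma measurableSet_sym : MeasurableSet {ω : Γ × Γ → Bool | pSym ω} := by
  simp only [pSym, Set.ofPred_forall]
  exact MeasurableSet.iInter fun x => MeasurableSet.iInter fun y =>
    measurableSet_eq_fun (measurable_pi_apply _) (measurable_pi_apply _)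

/-- cylinder sets in path space -/
def pcyl (n : ℕ) (y : ℕ → Γ) : Set (ℕ → Γ) := {x | ∀ i ≤ n, x i = y i}

lemma measurableSet_pcyl (n : ℕ) (y : ℕ → Γ) : MeasurableSet (pcyl n y) := by
  simp only [pcyl, Set.ofPred_forall]
  exact MeasurableSet.iInter fun i => MeasurableSet.iInter fun _ =>
    measurableSet_eq_fun (measurable_pi_apply i) measurable_const

/-- the family of cylinders -/
def pcyls (Γ : Type*) : Set (Set (ℕ → Γ)) := {E | ∃ (n : ℕ) (y : ℕ → Γ), E = {x : ℕ → Γ | ∀ i ≤ n, x i = y i}}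

lemma isPiSystem_pcyls : IsPiSystem (pcyls Γ) := by
  rintro _ ⟨n, y, rfl⟩ _ ⟨m, z, rfl⟩ ⟨w, hw1, hw2⟩
  refine ⟨max n m, w, ?_⟩
  ext x
  constructor
  · rintro ⟨h1, h2⟩ i hi
    rcases le_max_iff.1 hi with h | h
    · exact (h1 i h).trans (hw1 i h).symm
    · exact (h2 i h).trans (hw2 i h).symm
  · intro h
    exact ⟨fun i hi => (h i (hi.trans (le_max_left _ _))).trans (hw1 i hi),
      fun i hi => (h i (hi.trans (le_max_right _ _))).trans (hw2 i hi)⟩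

lemma generateFrom_pcyls :
    (MeasurableSpace.pi : MeasurableSpace (ℕ → Γ)) = MeasurableSpace.generateFrom (pcyls Γ) := by
  apply le_antisymm
  · refine iSup_le fun k => ?_
    rw [← measurable_iff_comap_le]
    refine @measurable_to_countable' _ _ _ _ (MeasurableSpace.generateFrom (pcyls Γ)) _ fun g => ?_
    have : (fun x : ℕ → Γ => x k) ⁻¹' {g} = ⋃ L : Fin (k + 1) → Γ, ⋃ _ : L (Fin.last k) = g,
        {x : ℕ → Γ | ∀ i ≤ k, x i = (fun j => if h : j < k + 1 then L ⟨j, h⟩ else 1) i} := by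
      ext x
      simp only [Set.mem_preimage, Set.mem_singleton_iff, Set.mem_iUnion]
      constructor
      · rintro rfl
        refine ⟨fun i => x i, by simp, fun i hi => ?_⟩
        simp [Nat.lt_succ_of_le hi]
      · rintro ⟨L, rfl, h⟩
        have := h k le_rfl
        simp only [Nat.lt_succ_self, dif_pos] at this
        exact this
    rw [this]
    refine MeasurableSet.iUnion fun L => MeasurableSet.iUnion fun _ => ?_
    exact MeasurableSpace.measurableSet_generateFrom ⟨_, _, rfl⟩
  · apply MeasurableSpace.generateFrom_le
    rintro _ ⟨n, y, rfl⟩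
    exact measurableSet_pcyl n y

end Perc

section Perc2

set_option linter.unusedSectionVars false
set_option linter.unusedVariables false

variable {Γ : Type*} [Group Γ] [Countable Γ] [DecidableEq Γ]
    [MeasurableSpace Γ] [MeasurableSingletonClass Γ] {S : Finset Γ}

/-- the cylinder formula -/
def PCyl (S : Finset Γ) (P : (Γ × Γ → Bool) → Measure (ℕ → Γ)) : Prop :=
  ∀ ω : Γ × Γ → Bool, ∀ n : ℕ, ∀ y : ℕ → Γ,
      P ω {x : ℕ → Γ | ∀ i ≤ n, x i = y i} =
        (if y 0 = 1 then 1 else 0) * ∏ i ∈ Finset.range n, percStep S ω (y i) (y (i + 1))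

/-- shift of a path -/
def psh (n : ℕ) (g : Γ) (x : ℕ → Γ) : ℕ → Γ := fun k => g⁻¹ * x (n + k)

lemma measurable_mulG (g : Γ) : Measurable (fun x : Γ => g * x) :=
  Measurable.of_discrete

lemma measurable_psh (n : ℕ) (g : Γ) : Measurable (psh n g : (ℕ → Γ) → _) :=
  measurable_pi_lambda _ fun k => (measurable_mulG _).comp (measurable_pi_apply _)

variable {P : (Γ × Γ → Bool) → Measure (ℕ → Γ)}

lemma markov (hPprob : ∀ ω, IsProbabilityMeasure (P ω)) (hP : PCyl S P) (ω : Γ × Γ → Bool)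
    (n : ℕ) (y : ℕ → Γ) {E : Set (ℕ → Γ)} (hE : MeasurableSet E) :
    P ω (psh n (y n) ⁻¹' E ∩ pcyl n y) = P ω (pcyl n y) * P (ptr (y n) ω) E := by
  have key : ((P ω).restrict (pcyl n y)).map (psh n (y n)) = P ω (pcyl n y) • P (ptr (y n) ω) := by
    refine ext_of_generate_finite (pcyls Γ) generateFrom_pcyls isPiSystem_pcyls ?_ ?_
    · rintro _ ⟨m, z, rfl⟩
      have hm : MeasurableSet {x : ℕ → Γ | ∀ i ≤ m, x i = z i} := measurableSet_pcyl m z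
      rw [Measure.map_apply (measurable_psh _ _) hm,
        Measure.restrict_apply (measurable_psh _ _ hm), Measure.smul_apply, smul_eq_mul, hP]
      by_cases hz : z 0 = 1
      · have : psh n (y n) ⁻¹' {x | ∀ i ≤ m, x i = z i} ∩ pcyl n y =
            {x | ∀ i ≤ n + m, x i = if i ≤ n then y i else y n * z (i - n)} := by
          ext x
          constructor
          · rintro ⟨h1, h2⟩ i hi
            split_ifs with h
            · exact h2 i h
            · have := h1 (i - n) (by omega)
              simp only [psh] at this
              rw [show n + (i - n) = i by omega] at this
              rw [← this]; simp
          · intro h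
            have h2 : x ∈ pcyl n y := fun i hi => by
              have := h i (by omega)
              simpa [hi] using this
            refine ⟨fun k hk => ?_, h2⟩
            simp only [psh]
            have h3 := h (n + k) (by omega)
            rcases Nat.eq_zero_or_pos k with rfl | hk0
            · rw [add_zero, h2 n le_rfl, hz]; simp
            · rw [h3, if_neg (by omega)]; simp
        rw [this, hP]
        change _ = P ω {x : ℕ → Γ | ∀ i ≤ n, x i = y i} * _
        rw [hP, Finset.prod_range_add]
        simp only [zero_le, if_true, hz, one_mul, mul_assoc]
        congr 2
        · refine Finset.prod_congr rfl fun i hi => ?_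
          have : i < n := Finset.mem_range.1 hi
          rw [if_pos this.le, if_pos (by omega)]
        · refine Finset.prod_congr rfl fun i hi => ?_
          rw [percStep_ptr]
          congr 1
          · rcases Nat.eq_zero_or_pos i with rfl | hi0
            · simp [hz]
            · rw [if_neg (by omega)]; simp
          · rw [if_neg (by omega)]
            congr 2; omega
      · rw [if_neg hz, zero_mul, mul_zero]
        convert measure_empty (μ := P ω)
        rw [Set.eq_empty_iff_forall_notMem]
        rintro x ⟨h1, h2⟩
        apply hz
        have h3 := h1 0 (Nat.zero_le _)
        have h4 := h2 n le_rfl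
        simp only [psh, add_zero] at h3
        rw [← h3, h4]; simp
    · rw [Measure.map_apply (measurable_psh _ _) MeasurableSet.univ]
      simp
  have := congrArg (fun m : Measure (ℕ → Γ) => m E) key
  simp only [Measure.map_apply (measurable_psh _ _) hE,
        Measure.restrict_apply (measurable_psh _ _ hE), Measure.smul_apply, smul_eq_mul] at this
  exact this

/-- the shift on the path bundle -/
def pT (p : (Γ × Γ → Bool) × (ℕ → Γ)) : (Γ × Γ → Bool) × (ℕ → Γ) :=
  (ptr (p.2 1) p.1, psh 1 (p.2 1) p.2)

lemma measurable_pT : Measurable (pT : (Γ × Γ → Bool) × (ℕ → Γ) → _) := by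
  refine Measurable.prodMk ?_ ?_
  · have h : Measurable (fun q : (Γ × Γ → Bool) × Γ => ptr q.2 q.1) :=
      measurable_from_prod_countable_left fun g => measurable_ptr g
    exact h.comp (measurable_fst.prodMk ((measurable_pi_apply 1).comp measurable_snd))
  · have h : Measurable (fun q : (ℕ → Γ) × Γ => psh 1 q.2 q.1) :=
      measurable_from_prod_countable_left fun g => measurable_psh 1 g
    exact h.comp (measurable_snd.prodMk ((measurable_pi_apply 1).comp measurable_snd))

lemma pT_iterate (p : (Γ × Γ → Bool) × (ℕ → Γ)) (hp : p.2 0 = 1) (n : ℕ) :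
    pT^[n] p = (ptr (p.2 n) p.1, psh n (p.2 n) p.2) := by
  induction n with
  | zero =>
    rw [Function.iterate_zero, id, hp, ptr_one]
    ext1
    · rfl
    · funext k; simp [psh]
  | succ n ih =>
    rw [Function.iterate_succ_apply', ih]
    simp only [pT, ptr_ptr]
    ext1
    · simp [psh]
    · funext k
      simp [psh, add_assoc]

lemma ae_zero_eq_one (hPprob : ∀ ω, IsProbabilityMeasure (P ω)) (hP : PCyl S P)
    (ω : Γ × Γ → Bool) : ∀ᵐ x ∂(P ω), x 0 = 1 := by
  have h := hP ω 0 (fun _ => 1)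
  simp only [if_true, Finset.range_zero, Finset.prod_empty, mul_one] at h
  have h2 := (prob_compl_eq_zero_iff (measurableSet_pcyl 0 (fun _ => (1 : Γ)))).2 h
  have h3 : ∀ᵐ x ∂(P ω), x ∈ pcyl 0 (fun _ => (1 : Γ)) := h2
  filter_upwards [h3] with x hx
  exact hx 0 le_rfl

lemma one_step (hPprob : ∀ ω, IsProbabilityMeasure (P ω)) (hP : PCyl S P) (ω : Γ × Γ → Bool)
    {A : Set ((Γ × Γ → Bool) × (ℕ → Γ))} (hA : MeasurableSet A) :
    P ω (Prod.mk ω ⁻¹' (pT ⁻¹' A)) =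
      ∑' g, percStep S ω 1 g * P (ptr g ω) (Prod.mk (ptr g ω) ⁻¹' A) := by
  have hAω : ∀ η, MeasurableSet (Prod.mk η ⁻¹' A) := fun η => measurable_prodMk_left hA
  have hm : MeasurableSet (Prod.mk ω ⁻¹' (pT ⁻¹' A)) := measurable_prodMk_left (measurable_pT hA)
  have h1 : Prod.mk ω ⁻¹' (pT ⁻¹' A) = ⋃ g : Γ, (Prod.mk ω ⁻¹' (pT ⁻¹' A)) ∩ {x | x 1 = g} := by
    ext x; simp
  have hm1 : ∀ g, MeasurableSet {x : ℕ → Γ | x 1 = g} := fun g =>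
    measurableSet_eq_fun (measurable_pi_apply 1) measurable_const
  rw [h1, measure_iUnion _ fun g => hm.inter (hm1 g)]
  · refine tsum_congr fun g => ?_
    set y : ℕ → Γ := fun i => if i = 0 then 1 else g with hy
    have hc : P ω (pcyl 1 y) = percStep S ω 1 g := by
      have := hP ω 1 y
      simpa [hy, pcyl] using this
    have h2 := markov hPprob hP ω 1 y (hAω (ptr g ω))
    have hy1 : y 1 = g := by simp [hy]
    rw [hc, hy1] at h2
    rw [← h2]
    apply measure_congr
    filter_upwards [ae_zero_eq_one hPprob hP ω] with x hx
    apply propext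
    constructor
    · rintro ⟨h3, h4⟩
      have h4 : x 1 = g := h4
      refine ⟨?_, ?_⟩
      · have h3 : (ptr (x 1) ω, psh 1 (x 1) x) ∈ A := h3
        rw [h4] at h3
        exact h3
      · intro i hi
        interval_cases i
        · simpa [hy] using hx
        · simpa [hy] using h4
    · rintro ⟨h3, h4⟩
      have h5 : x 1 = g := by rw [h4 1 le_rfl, hy1]
      refine ⟨?_, h5⟩
      change (ptr (x 1) ω, psh 1 (x 1) x) ∈ A
      rw [h5]
      exact h3
  · intro g h hgh
    rw [Function.onFun, Set.disjoint_left]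
    rintro x ⟨_, h1⟩ ⟨_, h2⟩
    exact hgh (h1.symm.trans h2)

lemma deg_mul_step {ω : Γ × Γ → Bool} (h : 0 < percDeg S ω 1) (G : Γ → ℝ≥0∞) :
    (percDeg S ω 1 : ℝ≥0∞) * ∑' g, percStep S ω 1 g * G g =
      ∑ s ∈ S, if ω (1, s) = true then G s else 0 := by
  rw [tsum_eq_sum (s := S), Finset.mul_sum]
  · refine Finset.sum_congr rfl fun s hs => ?_
    simp only [percStep, h, if_true, inv_one, one_mul, hs, true_and]
    split_ifs
    · rw [← mul_assoc, ENNReal.mul_inv_cancel, one_mul]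
      · simpa using h.ne'
      · simp
    · simp
  · intro s hs
    simp [percStep, h, hs]

variable {μ : Measure (Γ × Γ → Bool)}

lemma mass_transport (hS : ∀ s ∈ S, s⁻¹ ∈ S) (hmp : ∀ g : Γ, MeasurePreserving (ptr g) μ μ)
    (hsym : ∀ᵐ ω ∂μ, pSym ω) {G : (Γ × Γ → Bool) → ℝ≥0∞} (hG : Measurable G) :
    ∫⁻ ω in percOmega1 S, (∑ s ∈ S, if ω (1, s) = true then G (ptr s ω) else 0) ∂μ =
      ∫⁻ ω in percOmega1 S, (percDeg S ω 1 : ℝ≥0∞) * G ω ∂μ := by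
  have hΩ := measurableSet_omega1 (S := S)
  have hset : ∀ s : Γ, MeasurableSet {ω : Γ × Γ → Bool | ω (1, s) = true} := fun s =>
    measurableSet_eq_fun (measurable_pi_apply _) measurable_const
  rw [lintegral_finsetSum]
  swap
  · intro s _
    exact Measurable.ite (hset s) (hG.comp (measurable_ptr s)) measurable_const
  have h1 : ∀ s ∈ S, ∫⁻ ω in percOmega1 S, (if ω (1, s) = true then G (ptr s ω) else 0) ∂μ =
      ∫⁻ ω in percOmega1 S, (if ω (1, s⁻¹) = true then G ω else 0) ∂μ := by
    intro s hs
    rw [← lintegral_indicator hΩ, ← lintegral_indicator hΩ]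
    have hm : Measurable ((percOmega1 S).indicator
        (fun ω : Γ × Γ → Bool => if ω (1, s⁻¹) = true then G ω else 0)) :=
      (Measurable.ite (hset _) hG measurable_const).indicator hΩ
    rw [← (hmp s).lintegral_comp hm]
    apply lintegral_congr_ae
    filter_upwards [hsym] with ω hω
    have e1 : ptr s ω (1, s⁻¹) = ω (1, s) := by simp [ptr, hω s 1]
    by_cases h : ω (1, s) = true
    · have hcl : s ∈ percCluster S ω := by
        rw [mem_percCluster]
        exact Relation.ReflTransGen.single ⟨by simpa using hs, h⟩
      have := omega1_ptr hS hω hcl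
      by_cases h2 : ω ∈ percOmega1 S
      · rw [Set.indicator_of_mem h2, Set.indicator_of_mem (this.2 h2), e1]
      · rw [Set.indicator_of_notMem h2, Set.indicator_of_notMem (fun h => h2 (this.1 h))]
    · have a1 : ∀ c : ℝ≥0∞, (if ω (1, s) = true then c else 0) = 0 := fun c => if_neg h
      by_cases h2 : ω ∈ percOmega1 S <;> by_cases h3 : ptr s ω ∈ percOmega1 S <;>
        simp [h2, h3, e1, h]
  rw [Finset.sum_congr rfl h1, ← lintegral_finsetSum]
  · apply lintegral_congr
    intro ω
    rw [← Finset.sum_filter, Finset.sum_const, nsmul_eq_mul]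
    congr 2
    unfold percDeg
    apply Finset.card_bij (fun s _ => s⁻¹)
    · intro s hs
      rw [Finset.mem_filter] at hs
      rw [Finset.mem_filter]
      exact ⟨hS _ hs.1, by simpa using hs.2⟩
    · intro a _ b _ h
      exact inv_injective h
    · intro s hs
      rw [Finset.mem_filter] at hs
      exact ⟨s⁻¹, by rw [Finset.mem_filter]; exact ⟨hS _ hs.1, by simpa using hs.2⟩, by simp⟩
  · intro s _
    exact Measurable.ite (hset _) hG measurable_const

end Perc2

section Perc3

set_option linter.unusedSectionVars false
set_option linter.unusedVariables false

variable {Γ : Type*} [Group Γ] [Countable Γ] [DecidableEq Γ]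
    [MeasurableSpace Γ] [MeasurableSingletonClass Γ] {S : Finset Γ}
variable {P : (Γ × Γ → Bool) → Measure (ℕ → Γ)} {μ : Measure (Γ × Γ → Bool)}

lemma lam_apply (hPprob : ∀ ω, IsProbabilityMeasure (P ω)) (hPmeas : Measurable P)
    (D : ℝ) (hD : 0 ≤ D) (μ' : Measure (Γ × Γ → Bool))
    (hμ' : μ' = μ.withDensity
      (Set.indicator (percOmega1 S) (fun ω => ENNReal.ofReal ((percDeg S ω 1 : ℝ) / D))))
    (lam : Measure ((Γ × Γ → Bool) × (ℕ → Γ)))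
    (hlam : lam = μ'.bind (fun ω => (Measure.dirac ω).prod (P ω)))
    {A : Set ((Γ × Γ → Bool) × (ℕ → Γ))} (hA : MeasurableSet A) :
    lam A = ENNReal.ofReal D⁻¹ *
      ∫⁻ ω in percOmega1 S, (percDeg S ω 1 : ℝ≥0∞) * P ω (Prod.mk ω ⁻¹' A) ∂μ := by
  let K : ProbabilityTheory.Kernel (Γ × Γ → Bool) (ℕ → Γ) := ⟨P, hPmeas⟩
  have : ProbabilityTheory.IsMarkovKernel K := ⟨hPprob⟩
  have hΩ := measurableSet_omega1 (S := S)
  have e : (fun ω => (Measure.dirac ω).prod (P ω)) = ⇑(ProbabilityTheory.Kernel.id.prod K) := by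
    funext ω
    rw [ProbabilityTheory.Kernel.prod_apply, ProbabilityTheory.Kernel.id_apply]
    rfl
  have hGm : Measurable (fun ω => P ω (Prod.mk ω ⁻¹' A)) :=
    ProbabilityTheory.Kernel.measurable_kernel_prodMk_left (κ := K) hA
  have hdm : Measurable (fun ω : Γ × Γ → Bool => (percDeg S ω 1 : ℝ≥0∞)) :=
    (measurable_from_top (f := fun n : ℕ => (n : ℝ≥0∞))).comp (measurable_deg 1)
  rw [hlam, Measure.bind_apply hA (by rw [e]; exact (ProbabilityTheory.Kernel.measurable _).aemeasurable)]
  have e2 : ∀ ω, ((Measure.dirac ω).prod (P ω)) A = P ω (Prod.mk ω ⁻¹' A) := by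
    intro ω
    have := hPprob ω
    rw [Measure.dirac_prod, Measure.map_apply measurable_prodMk_left hA]
  simp only [e2]
  have hdm' : Measurable (fun ω : Γ × Γ → Bool => ENNReal.ofReal ((percDeg S ω 1 : ℝ) / D)) :=
    ((measurable_from_top (f := fun n : ℕ => ENNReal.ofReal ((n : ℝ) / D)))).comp (measurable_deg 1)
  have hprod : Measurable (fun ω : Γ × Γ → Bool =>
      (percDeg S ω 1 : ℝ≥0∞) * P ω (Prod.mk ω ⁻¹' A)) := hdm.mul hGm
  rw [hμ', lintegral_withDensity_eq_lintegral_mul _ (hdm'.indicator hΩ) hGm,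
    ← lintegral_const_mul _ hprod, ← lintegral_indicator hΩ]
  apply lintegral_congr
  intro ω
  simp only [Pi.mul_apply]
  by_cases h : ω ∈ percOmega1 S
  · rw [Set.indicator_of_mem h, Set.indicator_of_mem h, div_eq_mul_inv,
      ENNReal.ofReal_mul (Nat.cast_nonneg _), ENNReal.ofReal_natCast]
    ring
  · rw [Set.indicator_of_notMem h, Set.indicator_of_notMem h, zero_mul]

theorem mp_pT (hS : ∀ s ∈ S, s⁻¹ ∈ S) (hmp : ∀ g : Γ, MeasurePreserving (ptr g) μ μ)
    (hsym : ∀ᵐ ω ∂μ, pSym ω)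
    (hPprob : ∀ ω, IsProbabilityMeasure (P ω)) (hPmeas : Measurable P) (hP : PCyl S P)
    (lam : Measure ((Γ × Γ → Bool) × (ℕ → Γ))) (c0 : ℝ≥0∞)
    (hlam : ∀ A : Set ((Γ × Γ → Bool) × (ℕ → Γ)), MeasurableSet A → lam A = c0 *
      ∫⁻ ω in percOmega1 S, (percDeg S ω 1 : ℝ≥0∞) * P ω (Prod.mk ω ⁻¹' A) ∂μ) :
    MeasurePreserving pT lam lam := by
  refine ⟨measurable_pT, ?_⟩
  let K : ProbabilityTheory.Kernel (Γ × Γ → Bool) (ℕ → Γ) := ⟨P, hPmeas⟩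
  have : ProbabilityTheory.IsMarkovKernel K := ⟨hPprob⟩
  ext A hA
  have hGm : Measurable (fun ω => P ω (Prod.mk ω ⁻¹' A)) :=
    ProbabilityTheory.Kernel.measurable_kernel_prodMk_left (κ := K) hA
  rw [Measure.map_apply measurable_pT hA, hlam _ (measurable_pT hA), hlam _ hA,
    ← mass_transport hS hmp hsym hGm]
  congr 1
  refine setLIntegral_congr_fun measurableSet_omega1 fun ω hω => ?_
  rw [one_step hPprob hP ω hA, deg_mul_step (omega1_deg_pos hω)]

lemma step_ne_zero {ω : Γ × Γ → Bool} {x y : Γ} (h : percStep S ω x y ≠ 0) :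
    pR S ω x y ∨ y = x := by
  unfold percStep at h
  split_ifs at h with h1 h2 h3
  · exact Or.inl h2
  · exact absurd rfl h
  · exact Or.inr h3
  · exact absurd rfl h

lemma const_ergodic (hPprob : ∀ ω, IsProbabilityMeasure (P ω)) (hP : PCyl S P)
    {A : Set ((Γ × Γ → Bool) × (ℕ → Γ))} (hA : MeasurableSet A) (hinvA : pT ⁻¹' A = A)
    (ω : Γ × Γ → Bool)
    (hω : ∀ h ∈ percCluster S ω, P (ptr h ω) (Prod.mk (ptr h ω) ⁻¹' A) = P ω (Prod.mk ω ⁻¹' A)) :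
    P ω (Prod.mk ω ⁻¹' A) = 0 ∨ P ω (Prod.mk ω ⁻¹' A) = 1 := by
  have hAω : ∀ η, MeasurableSet (Prod.mk η ⁻¹' A) := fun η => measurable_prodMk_left hA
  have key : (P ω).restrict (Prod.mk ω ⁻¹' A) = P ω (Prod.mk ω ⁻¹' A) • P ω := by
    refine ext_of_generate_finite (pcyls Γ) generateFrom_pcyls isPiSystem_pcyls ?_ ?_
    · rintro _ ⟨n, y, rfl⟩
      have hm := measurableSet_pcyl n y
      change (P ω).restrict (Prod.mk ω ⁻¹' A) (pcyl n y) = (P ω (Prod.mk ω ⁻¹' A) • P ω) (pcyl n y)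
      rw [Measure.restrict_apply hm, Measure.smul_apply, smul_eq_mul]
      by_cases h0 : P ω (pcyl n y) = 0
      · rw [h0, mul_zero]
        exact measure_mono_null Set.inter_subset_left h0
      have h1 : P ω (pcyl n y) = _ := hP ω n y
      rw [h1] at h0
      have hy0 : y 0 = 1 := by
        by_contra h; simp [h] at h0
      have hst : ∀ i < n, percStep S ω (y i) (y (i + 1)) ≠ 0 := by
        have := right_ne_zero_of_mul h0
        rw [Finset.prod_ne_zero_iff] at this
        exact fun i hi => this i (Finset.mem_range.2 hi)
      have hcl : ∀ i ≤ n, y i ∈ percCluster S ω := by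
        intro i
        induction i with
        | zero => intro _; rw [hy0]; exact Relation.ReflTransGen.refl
        | succ i ih =>
          intro hi
          have h2 := ih (by omega)
          rcases step_ne_zero (hst i (by omega)) with h3 | h3
          · exact Relation.ReflTransGen.tail h2 h3
          · rw [h3]; exact h2
      have hset : pcyl n y ∩ Prod.mk ω ⁻¹' A =
          psh n (y n) ⁻¹' (Prod.mk (ptr (y n) ω) ⁻¹' A) ∩ pcyl n y := by
        rw [Set.inter_comm]
        ext x
        refine and_congr_left fun hx => ?_
        have hx0 : x 0 = 1 := (hx 0 (Nat.zero_le _)).trans hy0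
        have hit : pT^[n] ⁻¹' A = A := by
          have : ∀ n, pT^[n] ⁻¹' A = A := by
            intro n
            induction n with
            | zero => rfl
            | succ n ih => rw [Function.iterate_succ, Set.preimage_comp, ih, hinvA]
          exact this n
        have h5 : (ω, x) ∈ A ↔ pT^[n] (ω, x) ∈ A := by
          conv_lhs => rw [← hit]
          rfl
        rw [pT_iterate (ω, x) hx0 n] at h5
        simp only [hx n le_rfl] at h5
        exact h5
      rw [hset, markov hPprob hP ω n y (hAω _), hω _ (hcl n le_rfl), mul_comm]
    · simp
  have := congrArg (fun m : Measure (ℕ → Γ) => m (Prod.mk ω ⁻¹' A)) key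
  simp only [Measure.restrict_apply (hAω ω), Set.inter_self, Measure.smul_apply, smul_eq_mul] at this
  set t := P ω (Prod.mk ω ⁻¹' A) with ht
  have htop : t ≠ ∞ := measure_ne_top _ _
  by_cases h : t = 0
  · exact Or.inl h
  · right
    have h2 : t * 1 = t * t := by rwa [mul_one]
    exact ((ENNReal.mul_right_inj h htop).1 h2).symm

end Perc3

section Perc4

set_option linter.unusedSectionVars false
set_option linter.unusedVariables false

variable {Γ : Type*} [Group Γ] [Countable Γ] [DecidableEq Γ]
    [MeasurableSpace Γ] [MeasurableSingletonClass Γ] {S : Finset Γ}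
variable {P : (Γ × Γ → Bool) → Measure (ℕ → Γ)} {μ : Measure (Γ × Γ → Bool)}

lemma harmonic_identity {ω : Γ × Γ → Bool} (a : Γ → ℝ) (b : ℝ)
    (h : (percDeg S ω 1 : ℝ) * b = ∑ s ∈ S, if ω (1, s) = true then a s else 0) :
    (∑ s ∈ S, if ω (1, s) = true then ENNReal.ofReal (a s ^ 2) else 0) =
      (∑ s ∈ S, if ω (1, s) = true then ENNReal.ofReal ((a s - b) ^ 2) else 0) +
        (percDeg S ω 1 : ℝ≥0∞) * ENNReal.ofReal (b ^ 2) := by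
  simp only [← Finset.sum_filter] at h ⊢
  have hd : percDeg S ω 1 = (S.filter (fun s => ω (1, s) = true)).card := by
    unfold percDeg
    congr 1
    ext s
    rw [Finset.mem_filter, Finset.mem_filter, one_mul]
  rw [hd] at h ⊢
  set F := S.filter (fun s => ω (1, s) = true)
  rw [← ENNReal.ofReal_sum_of_nonneg fun i _ => sq_nonneg _,
    ← ENNReal.ofReal_sum_of_nonneg fun i _ => sq_nonneg _, ← ENNReal.ofReal_natCast,
    ← ENNReal.ofReal_mul (Nat.cast_nonneg _), ← ENNReal.ofReal_add
      (Finset.sum_nonneg fun i _ => sq_nonneg _) (by positivity)]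
  congr 1
  have : ∀ s, (a s - b) ^ 2 = a s ^ 2 - 2 * b * a s + b ^ 2 := fun s => by ring
  simp only [this, Finset.sum_add_distrib, Finset.sum_sub_distrib, ← Finset.mul_sum, ← h,
    Finset.sum_const, nsmul_eq_mul]
  ring

lemma harmonic_ae [IsProbabilityMeasure μ] (hS : ∀ s ∈ S, s⁻¹ ∈ S)
    (hmp : ∀ g : Γ, MeasurePreserving (ptr g) μ μ)
    (hsym : ∀ᵐ ω ∂μ, pSym ω) (f : (Γ × Γ → Bool) → ℝ) (hf : Measurable f)
    (h0 : ∀ ω, 0 ≤ f ω) (h1 : ∀ ω, f ω ≤ 1)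
    (hh : ∀ ω ∈ percOmega1 S,
      (percDeg S ω 1 : ℝ) * f ω = ∑ s ∈ S, if ω (1, s) = true then f (ptr s ω) else 0) :
    ∀ᵐ ω ∂μ, ω ∈ percOmega1 S → ∀ s ∈ S, ω (1, s) = true → f (ptr s ω) = f ω := by
  have hΩ := measurableSet_omega1 (S := S)
  have hf2 : Measurable (fun ω => ENNReal.ofReal (f ω ^ 2)) := (hf.pow_const 2).ennreal_ofReal
  have hset : ∀ s : Γ, MeasurableSet {ω : Γ × Γ → Bool | ω (1, s) = true} := fun s =>
    measurableSet_eq_fun (measurable_pi_apply _) measurable_const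
  have hdm : Measurable (fun ω : Γ × Γ → Bool => (percDeg S ω 1 : ℝ≥0∞)) :=
    (measurable_from_top (f := fun n : ℕ => (n : ℝ≥0∞))).comp (measurable_deg 1)
  have hmt := mass_transport (S := S) hS hmp hsym hf2
  set H : (Γ × Γ → Bool) → ℝ≥0∞ := fun ω =>
    ∑ s ∈ S, if ω (1, s) = true then ENNReal.ofReal ((f (ptr s ω) - f ω) ^ 2) else 0 with hH
  have hHm : Measurable H := Finset.measurable_sum _ fun s _ =>
    Measurable.ite (hset s) (((hf.comp (measurable_ptr s)).sub hf).pow_const 2).ennreal_ofReal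
      measurable_const
  have e : ∫⁻ ω in percOmega1 S,
      (∑ s ∈ S, if ω (1, s) = true then ENNReal.ofReal (f (ptr s ω) ^ 2) else 0) ∂μ =
      ∫⁻ ω in percOmega1 S, (H ω + (percDeg S ω 1 : ℝ≥0∞) * ENNReal.ofReal (f ω ^ 2)) ∂μ :=
    setLIntegral_congr_fun hΩ fun ω hω => harmonic_identity _ _ (hh ω hω)
  rw [e, lintegral_add_left hHm] at hmt
  have hfin : ∫⁻ ω in percOmega1 S, (percDeg S ω 1 : ℝ≥0∞) * ENNReal.ofReal (f ω ^ 2) ∂μ ≠ ∞ := by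
    refine ne_top_of_le_ne_top (b := ∫⁻ ω in percOmega1 S, (S.card : ℝ≥0∞) ∂μ) ?_ ?_
    · simp only [lintegral_const]
      exact ENNReal.mul_ne_top (ENNReal.natCast_ne_top _) (measure_ne_top _ _)
    · apply lintegral_mono
      intro ω
      calc (percDeg S ω 1 : ℝ≥0∞) * ENNReal.ofReal (f ω ^ 2) ≤ (S.card : ℝ≥0∞) * 1 := by
            gcongr
            · exact Finset.card_filter_le _ _
            · rw [ENNReal.ofReal_le_one]
              exact pow_le_one₀ (h0 _) (h1 _)
        _ = _ := mul_one _
  have hH0 : ∫⁻ ω in percOmega1 S, H ω ∂μ = 0 := by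
    rw [← zero_add (∫⁻ ω in percOmega1 S, (percDeg S ω 1 : ℝ≥0∞) * ENNReal.ofReal (f ω ^ 2) ∂μ)] at hmt
    simpa using (ENNReal.add_left_inj hfin).1 (by simpa using hmt)
  rw [lintegral_eq_zero_iff hHm] at hH0
  have := (ae_restrict_iff' hΩ).1 hH0
  filter_upwards [this] with ω hω hωΩ s hs hedge
  have h2 := hω hωΩ
  simp only [hH, Pi.zero_apply, Finset.sum_eq_zero_iff] at h2
  have h3 := h2 s hs
  rw [if_pos hedge, ENNReal.ofReal_eq_zero] at h3
  have : f (ptr s ω) - f ω = 0 := by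
    have := sq_nonneg (f (ptr s ω) - f ω)
    exact pow_eq_zero_iff (two_ne_zero) |>.1 (le_antisymm h3 this)
  linarith

lemma const_of_ind [IsProbabilityMeasure μ] (hS : ∀ s ∈ S, s⁻¹ ∈ S)
    (hmp : ∀ g : Γ, MeasurePreserving (ptr g) μ μ)
    (hsym : ∀ᵐ ω ∂μ, pSym ω)
    (hind : ∀ A : Set (Γ × Γ → Bool), MeasurableSet A → A ⊆ percOmega1 S →
      A = {ω ∈ percOmega1 S | ∃ g : Γ, g⁻¹ ∈ percCluster S ω ∧
        (fun p : Γ × Γ => ω (g⁻¹ * p.1, g⁻¹ * p.2)) ∈ A} →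
      μ A = 0 ∨ μ A = μ (percOmega1 S))
    (f : (Γ × Γ → Bool) → ℝ) (hf : Measurable f)
    (hh : ∀ᵐ ω ∂μ, ω ∈ percOmega1 S → ∀ s ∈ S, ω (1, s) = true → f (ptr s ω) = f ω) :
    ∃ c, ∀ᵐ ω ∂(μ.restrict (percOmega1 S)), f ω = c ∧
      ∀ h ∈ percCluster S ω, f (ptr h ω) = f ω := by
  have hΩ := measurableSet_omega1 (S := S)
  obtain ⟨Q, hQae, hQm, hQ⟩ := (hsym.and hh).exists_measurable_mem
  set W : Set (Γ × Γ → Bool) := ⋂ g : Γ, ptr g ⁻¹' Q with hW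
  have hWm : MeasurableSet W := MeasurableSet.iInter fun g => measurable_ptr g hQm
  have hWae : ∀ᵐ ω ∂μ, ω ∈ W := by
    have : ∀ᵐ ω ∂μ, ∀ g : Γ, ptr g ω ∈ Q := by
      rw [ae_all_iff]
      exact fun g => (hmp g).quasiMeasurePreserving.ae hQae
    filter_upwards [this] with ω hω
    exact Set.mem_iInter.2 hω
  have hWsym : ∀ ω ∈ W, pSym ω := fun ω hω => by
    have := (hQ _ (Set.mem_iInter.1 hω 1)).1
    rwa [ptr_one] at this
  have hWinv : ∀ ω (h : Γ), ptr h ω ∈ W → ω ∈ W := by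
    intro ω h hω
    refine Set.mem_iInter.2 fun g => ?_
    have := Set.mem_iInter.1 hω (h⁻¹ * g)
    rw [Set.mem_preimage, ptr_ptr] at this
    simpa using this
  have hWf : ∀ ω ∈ W, ω ∈ percOmega1 S → ∀ h ∈ percCluster S ω, f (ptr h ω) = f ω := by
    intro ω hω hωΩ h hh
    have hh' : Relation.ReflTransGen (pR S ω) 1 h := hh
    clear hh
    induction hh' with
    | refl => rw [ptr_one]
    | @tail b c hb hbc ih =>
      rw [← ih]
      have h2 := (hQ _ (Set.mem_iInter.1 hω b)).2 ((omega1_ptr hS (hWsym ω hω) hb).2 hωΩ)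
        (b⁻¹ * c) hbc.1 (by simpa [ptr] using hbc.2)
      rw [ptr_ptr] at h2
      simpa using h2
  obtain ⟨c, hc⟩ : ∃ c, f =ᶠ[ae (μ.restrict (percOmega1 S))] Function.const _ c := by
    apply exists_eventuallyEq_const_of_forall_separating MeasurableSet
    intro U hU
    set A : Set (Γ × Γ → Bool) := percOmega1 S ∩ (W ∩ f ⁻¹' U) with hAdef
    have hAm : MeasurableSet A := hΩ.inter (hWm.inter (hf hU))
    have hA := hind A hAm Set.inter_subset_left (by
      ext ω
      constructor
      · intro hω
        refine ⟨hω.1, 1, ?_, ?_⟩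
        · rw [inv_one]; exact Relation.ReflTransGen.refl
        · simpa using hω
      · rintro ⟨hω, g, hg, hgA⟩
        have hgA : ptr g⁻¹ ω ∈ A := hgA
        have hωW : ω ∈ W := hWinv ω _ hgA.2.1
        refine ⟨hω, hωW, ?_⟩
        have h3 : f (ptr g⁻¹ ω) ∈ U := hgA.2.2
        rw [hWf ω hωW hω _ hg] at h3
        exact h3)
    rcases hA with hA | hA
    · right
      rw [ae_restrict_iff' hΩ]
      have : ∀ᵐ ω ∂μ, ω ∉ A := measure_eq_zero_iff_ae_notMem.1 hA
      filter_upwards [this, hWae] with ω h1 h2 h3 h4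
      exact h1 ⟨h3, h2, h4⟩
    · left
      rw [ae_restrict_iff' hΩ]
      have := ae_eq_of_subset_of_measure_ge (s := A) (t := percOmega1 S) Set.inter_subset_left hA.ge
        hAm.nullMeasurableSet (measure_ne_top _ _)
      filter_upwards [this.mem_iff] with ω h1 h2
      exact (h1.2 h2).2.2
  refine ⟨c, ?_⟩
  filter_upwards [hc, ae_restrict_of_ae hWae, ae_restrict_mem hΩ] with ω h1 h2 h3
  exact ⟨h1, hWf ω h2 h3⟩

theorem ergodic_pT [IsProbabilityMeasure μ] (hS : ∀ s ∈ S, s⁻¹ ∈ S)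
    (hmp : ∀ g : Γ, MeasurePreserving (ptr g) μ μ)
    (hsym : ∀ᵐ ω ∂μ, pSym ω) (hpos : 0 < μ (percOmega1 S))
    (hind : ∀ A : Set (Γ × Γ → Bool), MeasurableSet A → A ⊆ percOmega1 S →
      A = {ω ∈ percOmega1 S | ∃ g : Γ, g⁻¹ ∈ percCluster S ω ∧
        (fun p : Γ × Γ => ω (g⁻¹ * p.1, g⁻¹ * p.2)) ∈ A} →
      μ A = 0 ∨ μ A = μ (percOmega1 S))
    (hPprob : ∀ ω, IsProbabilityMeasure (P ω)) (hPmeas : Measurable P) (hP : PCyl S P)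
    (lam : Measure ((Γ × Γ → Bool) × (ℕ → Γ))) [IsProbabilityMeasure lam] (c0 : ℝ≥0∞)
    (hlam : ∀ A : Set ((Γ × Γ → Bool) × (ℕ → Γ)), MeasurableSet A → lam A = c0 *
      ∫⁻ ω in percOmega1 S, (percDeg S ω 1 : ℝ≥0∞) * P ω (Prod.mk ω ⁻¹' A) ∂μ) :
    Ergodic pT lam := by
  refine ⟨mp_pT hS hmp hsym hPprob hPmeas hP lam c0 hlam, ⟨fun A hA hinvA => ?_⟩⟩
  have hΩ := measurableSet_omega1 (S := S)
  let K : ProbabilityTheory.Kernel (Γ × Γ → Bool) (ℕ → Γ) := ⟨P, hPmeas⟩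
  have : ProbabilityTheory.IsMarkovKernel K := ⟨hPprob⟩
  set G : (Γ × Γ → Bool) → ℝ≥0∞ := fun ω => P ω (Prod.mk ω ⁻¹' A) with hG
  have hGm : Measurable G :=
    ProbabilityTheory.Kernel.measurable_kernel_prodMk_left (κ := K) hA
  have hG1 : ∀ ω, G ω ≤ 1 := fun ω => prob_le_one
  have hGtop : ∀ ω, G ω ≠ ∞ := fun ω => measure_ne_top _ _
  have hharm : ∀ ω ∈ percOmega1 S,
      (percDeg S ω 1 : ℝ) * (G ω).toReal =
        ∑ s ∈ S, if ω (1, s) = true then (G (ptr s ω)).toReal else 0 := by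
    intro ω hω
    have h1 := one_step hPprob hP ω hA
    rw [hinvA] at h1
    have h2 := deg_mul_step (omega1_deg_pos hω) (fun g => G (ptr g ω))
    simp only [hG] at h2
    rw [← h1] at h2
    have h3 := congrArg ENNReal.toReal h2
    rw [ENNReal.toReal_mul, ENNReal.toReal_natCast, ENNReal.toReal_sum] at h3
    · rw [h3]
      refine Finset.sum_congr rfl fun s _ => ?_
      split_ifs <;> rfl
    · intro s _
      split_ifs
      · exact hGtop _
      · simp
  have hae := harmonic_ae hS hmp hsym (fun ω => (G ω).toReal) hGm.ennreal_toReal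
    (fun ω => ENNReal.toReal_nonneg) (fun ω => ENNReal.toReal_le_of_le_ofReal zero_le_one
      (by simpa using hG1 ω)) hharm
  obtain ⟨c, hc⟩ := const_of_ind hS hmp hsym hind (fun ω => (G ω).toReal) hGm.ennreal_toReal hae
  have hne : (ae (μ.restrict (percOmega1 S))).NeBot := by
    rw [ae_neBot]
    intro h
    rw [Measure.restrict_eq_zero] at h
    exact hpos.ne' h
  obtain ⟨ω, hω1, hω2⟩ := hc.exists
  have hdich := const_ergodic hPprob hP hA hinvA ω
    (fun h hh => (ENNReal.toReal_eq_toReal_iff' (hGtop _) (hGtop _)).1 (hω2 h hh))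
  have hGc : ∀ᵐ η ∂(μ.restrict (percOmega1 S)), G η = G ω := by
    filter_upwards [hc] with η hη
    exact (ENNReal.toReal_eq_toReal_iff' (hGtop _) (hGtop _)).1 (hη.1.trans hω1.symm)
  rw [eventuallyConst_set']
  rcases hdich with h | h
  · left
    rw [ae_eq_empty, hlam A hA]
    have : ∫⁻ ω in percOmega1 S, (percDeg S ω 1 : ℝ≥0∞) * P ω (Prod.mk ω ⁻¹' A) ∂μ =
        ∫⁻ ω in percOmega1 S, 0 ∂μ := by
      apply lintegral_congr_ae
      filter_upwards [hGc] with η hη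
      change _ * G η = 0
      rw [hη, show G ω = 0 from h, mul_zero]
    rw [this]; simp
  · right
    rw [ae_eq_univ, prob_compl_eq_zero_iff hA, hlam A hA]
    rw [← measure_univ (μ := lam), hlam _ MeasurableSet.univ]
    congr 1
    apply lintegral_congr_ae
    filter_upwards [hGc] with η hη
    change _ * G η = _
    rw [hη, show G ω = 1 from h]
    simp

end Perc4

section Perc5

set_option linter.unusedSectionVars false
set_option linter.unusedVariables false

variable {Γ : Type*} [Group Γ] [Countable Γ] [DecidableEq Γ]
    [MeasurableSpace Γ] [MeasurableSingletonClass Γ] {S : Finset Γ}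
variable {P : (Γ × Γ → Bool) → Measure (ℕ → Γ)} {μ : Measure (Γ × Γ → Bool)}

lemma kernel_singleton (ω : Γ × Γ → Bool) (x z : Γ) :
    percKernel S ω x {z} = percStep S ω x z := by
  unfold percKernel percStep
  split_ifs with h1 h2 h2
  · rw [Measure.finsetSum_apply, Finset.sum_eq_single (x⁻¹ * z)]
    · simp
    · intro b _ hb
      have : x * b ≠ z := fun h => hb (by rw [← h]; simp)
      simp [this]
    · intro h
      exact absurd (Finset.mem_filter.2 ⟨h2.1, by simpa using h2.2⟩) h
  · rw [Measure.finsetSum_apply]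
    refine Finset.sum_eq_zero fun s hs => ?_
    rw [Finset.mem_filter] at hs
    have : x * s ≠ z := fun h => h2 (by subst h; simpa using hs)
    simp [this]
  · simp [h2]
  · have : x ≠ z := fun h => h2 h.symm
    simp [this]

lemma kernel_univ (ω : Γ × Γ → Bool) (x : Γ) : percKernel S ω x Set.univ = 1 := by
  unfold percKernel
  split_ifs with h1
  · rw [Measure.finsetSum_apply]
    simp only [Measure.smul_apply, measure_univ, smul_eq_mul, mul_one, Finset.sum_const,
      nsmul_eq_mul]
    exact ENNReal.mul_inv_cancel (by unfold percDeg at h1; exact_mod_cast h1.ne')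
      (ENNReal.natCast_ne_top _)
  · simp

lemma iter_univ (ω : Γ × Γ → Bool) (n : ℕ) (x : Γ) : percIter S ω n x Set.univ = 1 := by
  induction n with
  | zero => simp [percIter]
  | succ n ih =>
    simp only [percIter]
    rw [Measure.bind_apply MeasurableSet.univ (Measurable.of_discrete).aemeasurable]
    simp [kernel_univ, ih]

lemma iter_succ (ω : Γ × Γ → Bool) (n : ℕ) (x z : Γ) : percIter S ω (n + 1) x {z} =
    ∑' y, percStep S ω y z * percIter S ω n x {y} := by
  simp only [percIter]
  rw [Measure.bind_apply (measurableSet_singleton z) (Measurable.of_discrete).aemeasurable,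
    lintegral_countable']
  simp only [kernel_singleton]

lemma iter_one (ω : Γ × Γ → Bool) (x z : Γ) : percIter S ω 1 x {z} = percStep S ω x z := by
  change ((Measure.dirac x).bind (percKernel S ω)) {z} = _
  rw [Measure.dirac_bind Measurable.of_discrete, kernel_singleton]

lemma iter_add (ω : Γ × Γ → Bool) (n m : ℕ) (x : Γ) :
    percIter S ω (n + m) x = (percIter S ω n x).bind (percIter S ω m) := by
  induction m with
  | zero =>
    change percIter S ω n x = (percIter S ω n x).bind Measure.dirac
    rw [Measure.bind_dirac]
  | succ m ih =>
    change (percIter S ω (n + m) x).bind (percKernel S ω) =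
      (percIter S ω n x).bind (fun y => (percIter S ω m y).bind (percKernel S ω))
    rw [ih, Measure.bind_bind (Measurable.of_discrete).aemeasurable
      (Measurable.of_discrete).aemeasurable]

lemma iter_super (ω : Γ × Γ → Bool) (n m : ℕ) (x y z : Γ) :
    percIter S ω n x {y} * percIter S ω m y {z} ≤ percIter S ω (n + m) x {z} := by
  rw [iter_add, Measure.bind_apply (measurableSet_singleton z)
    (Measurable.of_discrete).aemeasurable, lintegral_countable', mul_comm]
  exact ENNReal.le_tsum (f := fun a => percIter S ω m a {z} * percIter S ω n x {a}) y

lemma iter_ptr (ω : Γ × Γ → Bool) (n : ℕ) (g x y : Γ) :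
    percIter S (ptr g ω) n x {y} = percIter S ω n (g * x) {g * y} := by
  induction n generalizing y with
  | zero => simp [percIter, Set.indicator]
  | succ n ih =>
    rw [iter_succ, iter_succ, ← (Equiv.mulLeft g).tsum_eq
      (fun z => percStep S ω z (g * y) * percIter S ω n (g * x) {z})]
    simp only [ih, percStep_ptr, Equiv.coe_mulLeft]

lemma measurable_iter (n : ℕ) (x y : Γ) :
    Measurable (fun ω : Γ × Γ → Bool => percIter S ω n x {y}) := by
  induction n generalizing y with
  | zero => exact measurable_const
  | succ n ih =>
    simp only [iter_succ]
    exact Measurable.tsum fun z => (measurable_step z y).mul (ih z)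

lemma measurable_q (n : ℕ) : Measurable
    (fun p : (Γ × Γ → Bool) × (ℕ → Γ) => percIter S p.1 n 1 {p.2 n}) := by
  have h : Measurable (fun p : (Γ × Γ → Bool) × Γ => percIter S p.1 n 1 {p.2}) :=
    measurable_from_prod_countable_left fun y => measurable_iter n 1 y
  exact h.comp (measurable_fst.prodMk ((measurable_pi_apply n).comp measurable_snd))

lemma q_super (p : (Γ × Γ → Bool) × (ℕ → Γ)) (hp : p.2 0 = 1) (n m : ℕ) :
    percIter S p.1 n 1 {p.2 n} * percIter S (pT^[n] p).1 m 1 {(pT^[n] p).2 m} ≤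
      percIter S p.1 (n + m) 1 {p.2 (n + m)} := by
  rw [pT_iterate p hp n]
  simp only [psh]
  rw [iter_ptr]
  simp only [mul_one, mul_inv_cancel_left]
  exact iter_super _ _ _ _ _ _

lemma wl_exists (hS : ∀ s ∈ S, s⁻¹ ∈ S) (hgen : Subgroup.closure (S : Set Γ) = ⊤) (g : Γ) :
    ∃ L : List Γ, L.length = wordLength S g ∧ (∀ a ∈ L, a ∈ S) ∧ L.prod = g := by
  have hne : {n : ℕ | ∃ L : List Γ, L.length = n ∧ (∀ a ∈ L, a ∈ S) ∧ L.prod = g}.Nonempty := by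
    have hg : g ∈ (Subgroup.closure (S : Set Γ)).toSubmonoid := by rw [hgen]; trivial
    rw [Subgroup.closure_toSubmonoid] at hg
    obtain ⟨L, hL, hp⟩ := Submonoid.exists_list_of_mem_closure hg
    refine ⟨L.length, L, rfl, fun a ha => ?_, hp⟩
    rcases hL a ha with h | h
    · exact h
    · have := hS _ h
      rwa [inv_inv] at this
  exact Nat.sInf_mem hne

lemma wl_le (L : List Γ) (hL : ∀ a ∈ L, a ∈ S) : wordLength S L.prod ≤ L.length :=
  Nat.sInf_le ⟨L, rfl, hL, rfl⟩

lemma wl_one : wordLength S (1 : Γ) = 0 := by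
  have := wl_le (S := S) [] (by simp)
  simpa using this

lemma wl_mem {s : Γ} (hs : s ∈ S) : wordLength S s ≤ 1 := by
  have := wl_le (S := S) [s] (by simpa using hs)
  simpa using this

lemma wl_mul (hS : ∀ s ∈ S, s⁻¹ ∈ S) (hgen : Subgroup.closure (S : Set Γ) = ⊤) (g h : Γ) :
    wordLength S (g * h) ≤ wordLength S g + wordLength S h := by
  obtain ⟨L, h1, h2, h3⟩ := wl_exists hS hgen g
  obtain ⟨M, k1, k2, k3⟩ := wl_exists hS hgen h
  have := wl_le (S := S) (L ++ M) (by
    intro a ha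
    rcases List.mem_append.1 ha with h | h
    · exact h2 a h
    · exact k2 a h)
  rwa [List.prod_append, h3, k3, List.length_append, h1, k1] at this

lemma ae_first (hPprob : ∀ ω, IsProbabilityMeasure (P ω)) (hP : PCyl S P) (ω : Γ × Γ → Bool) :
    ∀ᵐ x ∂(P ω), percStep S ω 1 (x 1) ≠ 0 := by
  have h : ∀ᵐ x ∂(P ω), ∀ g : Γ, percStep S ω 1 g = 0 → ¬ (x 0 = 1 ∧ x 1 = g) := by
    rw [ae_all_iff]
    intro g
    by_cases hg : percStep S ω 1 g = 0
    · have h1 := hP ω 1 (fun i => if i = 0 then 1 else g)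
      simp [hg] at h1
      have h2 := measure_eq_zero_iff_ae_notMem.1 h1
      filter_upwards [h2] with x hx _ hx2
      apply hx
      intro i hi
      rcases Nat.le_one_iff_eq_zero_or_eq_one.1 hi with rfl | rfl
      · simpa using hx2.1
      · simpa using hx2.2
    · exact Eventually.of_forall fun x h => absurd h hg
  filter_upwards [h, ae_zero_eq_one hPprob hP ω] with x hx hx0 hc
  exact hx _ hc ⟨hx0, rfl⟩

lemma measurableSet_first : MeasurableSet {p : (Γ × Γ → Bool) × (ℕ → Γ) |
    p.1 ∈ percOmega1 S ∧ p.2 0 = 1 ∧ percStep S p.1 1 (p.2 1) ≠ 0} := by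
  have h : Measurable (fun p : (Γ × Γ → Bool) × Γ => percStep S p.1 1 p.2) :=
    measurable_from_prod_countable_left fun y => measurable_step 1 y
  have h' : Measurable (fun p : (Γ × Γ → Bool) × (ℕ → Γ) => percStep S p.1 1 (p.2 1)) :=
    h.comp (measurable_fst.prodMk ((measurable_pi_apply 1).comp measurable_snd))
  refine (measurable_fst measurableSet_omega1).inter (MeasurableSet.inter ?_ ?_)
  · exact measurableSet_eq_fun ((measurable_pi_apply 0).comp measurable_snd) measurable_const
  · exact (h' (measurableSet_singleton 0)).compl

lemma ae_good (hPprob : ∀ ω, IsProbabilityMeasure (P ω)) (hP : PCyl S P)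
    (lam : Measure ((Γ × Γ → Bool) × (ℕ → Γ))) (c0 : ℝ≥0∞)
    (hlam : ∀ A : Set ((Γ × Γ → Bool) × (ℕ → Γ)), MeasurableSet A → lam A = c0 *
      ∫⁻ ω in percOmega1 S, (percDeg S ω 1 : ℝ≥0∞) * P ω (Prod.mk ω ⁻¹' A) ∂μ) :
    ∀ᵐ p ∂lam, p.1 ∈ percOmega1 S ∧ p.2 0 = 1 ∧ percStep S p.1 1 (p.2 1) ≠ 0 := by
  have hm := measurableSet_first (S := S)
  set A := {p : (Γ × Γ → Bool) × (ℕ → Γ) |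
    p.1 ∈ percOmega1 S ∧ p.2 0 = 1 ∧ percStep S p.1 1 (p.2 1) ≠ 0} with hA
  change lam Aᶜ = 0
  rw [hlam _ hm.compl]
  have : ∫⁻ ω in percOmega1 S, (percDeg S ω 1 : ℝ≥0∞) * P ω (Prod.mk ω ⁻¹' Aᶜ) ∂μ =
      ∫⁻ ω in percOmega1 S, 0 ∂μ := by
    refine setLIntegral_congr_fun measurableSet_omega1 fun ω hω => ?_
    have : P ω (Prod.mk ω ⁻¹' Aᶜ) = 0 := by
      have h : ∀ᵐ x ∂(P ω), (ω, x) ∈ A := by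
        filter_upwards [ae_zero_eq_one hPprob hP ω, ae_first hPprob hP ω] with x h1 h2
        exact ⟨hω, h1, h2⟩
      exact h
    simp only [this, mul_zero]
  rw [this]; simp

lemma good_mem {ω : Γ × Γ → Bool} (hω : ω ∈ percOmega1 S) {g : Γ} (hg : percStep S ω 1 g ≠ 0) :
    g ∈ S ∧ ((S.card : ℝ≥0∞))⁻¹ ≤ percStep S ω 1 g := by
  unfold percStep at hg ⊢
  rw [if_pos (omega1_deg_pos hω)] at hg ⊢
  split_ifs at hg ⊢ with h
  · refine ⟨by simpa using h.1, ?_⟩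
    rw [ENNReal.inv_le_inv]
    exact_mod_cast Finset.card_filter_le _ _
  · exact absurd rfl hg

theorem main_aux (hS : ∀ s ∈ S, s⁻¹ ∈ S) (hgen : Subgroup.closure (S : Set Γ) = ⊤)
    (hPprob : ∀ ω, IsProbabilityMeasure (P ω)) (hP : PCyl S P)
    (lam : Measure ((Γ × Γ → Bool) × (ℕ → Γ))) [IsProbabilityMeasure lam] (c0 : ℝ≥0∞)
    (hlam : ∀ A : Set ((Γ × Γ → Bool) × (ℕ → Γ)), MeasurableSet A → lam A = c0 *
      ∫⁻ ω in percOmega1 S, (percDeg S ω 1 : ℝ≥0∞) * P ω (Prod.mk ω ⁻¹' A) ∂μ)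
    (herg : Ergodic pT lam) :
    ∃ l : ℝ, ∃ h : ℝ, 0 ≤ l ∧ 0 ≤ h ∧ ∀ᵐ p ∂lam,
      Tendsto (fun n : ℕ => (wordLength S (p.2 n) : ℝ) / n) atTop (𝓝 l) ∧
      Tendsto (fun n : ℕ => -(Real.log ((percIter S p.1 n 1 {p.2 n}).toReal)) / n)
        atTop (𝓝 h) := by
  have hgood := ae_good hPprob hP lam c0 hlam
  have horb := kg_ae_orbit herg.toMeasurePreserving hgood
  obtain ⟨l, hl0, hl⟩ := kg_main herg
    (fun n (p : (Γ × Γ → Bool) × (ℕ → Γ)) => (wordLength S (p.2 n) : ℝ))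
    (fun n => (Measurable.of_discrete (f := fun g : Γ => (wordLength S g : ℝ))).comp
      ((measurable_pi_apply n).comp measurable_snd)) 1
    (Eventually.of_forall fun p n => Nat.cast_nonneg _)
    (by filter_upwards [hgood] with p hp
        rw [hp.2.1, wl_one]; simp)
    (by filter_upwards [hgood] with p hp
        exact_mod_cast wl_mem (good_mem hp.1 hp.2.2).1)
    (by filter_upwards [hgood] with p hp n m
        rw [pT_iterate p hp.2.1 n]
        have := wl_mul hS hgen (p.2 n) ((p.2 n)⁻¹ * p.2 (n + m))
        rw [mul_inv_cancel_left] at this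
        exact_mod_cast this)
  have hle1 : ∀ (p : (Γ × Γ → Bool) × (ℕ → Γ)) (n : ℕ), percIter S p.1 n 1 {p.2 n} ≤ 1 :=
    fun p n => (measure_mono (Set.subset_univ _)).trans (iter_univ _ _ _).le
  have hpos : ∀ᵐ p ∂lam, ∀ n, percIter S p.1 n 1 {p.2 n} ≠ 0 := by
    filter_upwards [horb] with p hp n
    have hp0 : p.2 0 = 1 := (hp 0).2.1
    induction n with
    | zero => simp [percIter, hp0]
    | succ n ih =>
      have h1 := q_super (S := S) p hp0 n 1
      have h2 : percIter S (pT^[n] p).1 1 1 {(pT^[n] p).2 1} ≠ 0 := by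
        rw [iter_one]; exact (hp n).2.2
      intro h3
      rw [h3] at h1
      exact mul_ne_zero ih h2 (le_antisymm h1 (zero_le))
  obtain ⟨h, hh0, hh⟩ := kg_main herg
    (fun n (p : (Γ × Γ → Bool) × (ℕ → Γ)) => -(Real.log ((percIter S p.1 n 1 {p.2 n}).toReal)))
    (fun n => (Real.measurable_log.comp (measurable_q n).ennreal_toReal).neg)
    (Real.log S.card)
    (Eventually.of_forall fun p n => neg_nonneg.2 (Real.log_nonpos ENNReal.toReal_nonneg
      (ENNReal.toReal_le_of_le_ofReal zero_le_one (by simpa using hle1 p n))))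
    (by filter_upwards [hgood] with p hp
        simp [percIter, hp.2.1])
    (by filter_upwards [hgood] with p hp
        have h1 := good_mem hp.1 hp.2.2
        rw [← iter_one] at h1
        have hc : 0 < S.card := Finset.card_pos.2 ⟨_, h1.1⟩
        have h2 := ENNReal.toReal_mono (ne_top_of_le_ne_top ENNReal.one_ne_top (hle1 p 1)) h1.2
        rw [ENNReal.toReal_inv, ENNReal.toReal_natCast] at h2
        have h3 := Real.log_le_log (by positivity) h2
        rw [Real.log_inv] at h3
        linarith)
    (by filter_upwards [hgood, hpos, kg_ae_orbit herg.toMeasurePreserving hpos]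
          with p hp hq hq2 n m
        have h1 := q_super (S := S) p hp.2.1 n m
        have h2 := ENNReal.toReal_mono
          (ne_top_of_le_ne_top ENNReal.one_ne_top (hle1 p (n + m))) h1
        rw [ENNReal.toReal_mul] at h2
        have p1 : 0 < (percIter S p.1 n 1 {p.2 n}).toReal := ENNReal.toReal_pos (hq n)
          (ne_top_of_le_ne_top ENNReal.one_ne_top (hle1 p n))
        have p2 : 0 < (percIter S (pT^[n] p).1 m 1 {(pT^[n] p).2 m}).toReal :=
          ENNReal.toReal_pos (hq2 n m)
          (ne_top_of_le_ne_top ENNReal.one_ne_top (hle1 _ m))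
        have h3 := Real.log_le_log (mul_pos p1 p2) h2
        rw [Real.log_mul p1.ne' p2.ne'] at h3
        linarith)
  refine ⟨l, h, hl0, hh0, ?_⟩
  filter_upwards [hl, hh] with p h1 h2
  exact ⟨h1, h2⟩

lemma D_fact [IsProbabilityMeasure μ] (hpos : 0 < μ (percOmega1 S))
    (D : ℝ) (hD : D = ∫ ω in percOmega1 S, (percDeg S ω 1 : ℝ) ∂μ) :
    0 < D ∧ ENNReal.ofReal D = ∫⁻ ω in percOmega1 S, (percDeg S ω 1 : ℝ≥0∞) ∂μ := by
  have hΩ := measurableSet_omega1 (S := S)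
  have hm : Measurable (fun ω : Γ × Γ → Bool => (percDeg S ω 1 : ℝ)) :=
    (measurable_from_top (f := fun n : ℕ => (n : ℝ))).comp (measurable_deg 1)
  have hi : Integrable (fun ω : Γ × Γ → Bool => (percDeg S ω 1 : ℝ)) (μ.restrict (percOmega1 S)) := by
    refine Integrable.of_bound hm.aestronglyMeasurable (S.card : ℝ) (Eventually.of_forall fun ω => ?_)
    rw [Real.norm_of_nonneg (Nat.cast_nonneg _)]
    exact_mod_cast Finset.card_filter_le _ _
  have e : ENNReal.ofReal D = ∫⁻ ω in percOmega1 S, (percDeg S ω 1 : ℝ≥0∞) ∂μ := by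
    rw [hD, ofReal_integral_eq_lintegral_ofReal hi (Eventually.of_forall fun ω => Nat.cast_nonneg _)]
    simp only [ENNReal.ofReal_natCast]
  refine ⟨?_, e⟩
  rw [← ENNReal.ofReal_pos, e]
  refine hpos.trans_le ?_
  calc μ (percOmega1 S) = ∫⁻ ω in percOmega1 S, 1 ∂μ := by simp
    _ ≤ _ := setLIntegral_mono' hΩ fun ω hω => by exact_mod_cast omega1_deg_pos hω

lemma mp_ptr (hinv : ∀ g : Γ,
      Measure.map (fun (ω : Γ × Γ → Bool) (p : Γ × Γ) => ω (g⁻¹ * p.1, g⁻¹ * p.2)) μ = μ) (g : Γ) :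
    MeasurePreserving (ptr g) μ μ := by
  refine ⟨measurable_ptr g, ?_⟩
  have := hinv g⁻¹
  rw [inv_inv] at this
  exact this

end Perc5

/-- for an ergodic invariant percolation with indistinguishable infinite
clusters, the simple random walks on the clusters have deterministic speed `l` and
entropy `h` (regularity part of Theorem 5.6). -/
theorem stmt_14 {Γ : Type*} [Group Γ] [Countable Γ] [DecidableEq Γ]
    [MeasurableSpace Γ] [MeasurableSingletonClass Γ]
    (S : Finset Γ) (hS1 : (1 : Γ) ∉ S) (hSsymm : ∀ s ∈ S, s⁻¹ ∈ S)
    (hSgen : Subgroup.closure (S : Set Γ) = ⊤)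
    (μ : Measure (Γ × Γ → Bool)) [IsProbabilityMeasure μ]
    (hinv : ∀ g : Γ,
      Measure.map (fun (ω : Γ × Γ → Bool) (p : Γ × Γ) => ω (g⁻¹ * p.1, g⁻¹ * p.2)) μ = μ)
    (herg : ∀ A : Set (Γ × Γ → Bool), MeasurableSet A →
      (∀ g : Γ, (fun (ω : Γ × Γ → Bool) (p : Γ × Γ) => ω (g⁻¹ * p.1, g⁻¹ * p.2)) ⁻¹' A = A) →
      μ A = 0 ∨ μ A = 1)
    (hsymm : ∀ᵐ ω ∂μ, ∀ x y : Γ, ω (x, y) = ω (y, x))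
    (hpos : 0 < μ (percOmega1 S))
    (hind : ∀ A : Set (Γ × Γ → Bool), MeasurableSet A → A ⊆ percOmega1 S →
      A = {ω ∈ percOmega1 S | ∃ g : Γ, g⁻¹ ∈ percCluster S ω ∧
        (fun p : Γ × Γ => ω (g⁻¹ * p.1, g⁻¹ * p.2)) ∈ A} →
      μ A = 0 ∨ μ A = μ (percOmega1 S))
    (D : ℝ) (hD : D = ∫ ω in percOmega1 S, (percDeg S ω 1 : ℝ) ∂μ)
    (μ' : Measure (Γ × Γ → Bool))
    (hμ' : μ' = μ.withDensity
      (Set.indicator (percOmega1 S) (fun ω => ENNReal.ofReal ((percDeg S ω 1 : ℝ) / D))))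
    (P : (Γ × Γ → Bool) → Measure (ℕ → Γ))
    (hPprob : ∀ ω, IsProbabilityMeasure (P ω))
    (hPmeas : Measurable P)
    (hPcyl : ∀ ω : Γ × Γ → Bool, ∀ n : ℕ, ∀ y : ℕ → Γ,
      P ω {x : ℕ → Γ | ∀ i ≤ n, x i = y i} =
        (if y 0 = 1 then 1 else 0) * ∏ i ∈ Finset.range n, percStep S ω (y i) (y (i + 1)))
    (lam : Measure ((Γ × Γ → Bool) × (ℕ → Γ)))
    (hlam : lam = μ'.bind (fun ω => (Measure.dirac ω).prod (P ω))) :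
    ∃ l : ℝ, ∃ h : ℝ, 0 ≤ l ∧ 0 ≤ h ∧ ∀ᵐ p ∂lam,
      Tendsto (fun n : ℕ => (wordLength S (p.2 n) : ℝ) / n) atTop (𝓝 l) ∧
      Tendsto (fun n : ℕ => -(Real.log ((percIter S p.1 n 1 {p.2 n}).toReal)) / n)
        atTop (𝓝 h) := by
  obtain ⟨hDpos, hDeq⟩ := D_fact (S := S) hpos D hD
  have hmp := mp_ptr hinv
  have hL : ∀ A : Set ((Γ × Γ → Bool) × (ℕ → Γ)), MeasurableSet A → lam A = ENNReal.ofReal D⁻¹ *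
      ∫⁻ ω in percOmega1 S, (percDeg S ω 1 : ℝ≥0∞) * P ω (Prod.mk ω ⁻¹' A) ∂μ :=
    fun A hA => lam_apply hPprob hPmeas D hDpos.le μ' hμ' lam hlam hA
  have hprob : IsProbabilityMeasure lam := by
    refine ⟨?_⟩
    rw [hL _ MeasurableSet.univ]
    simp only [Set.preimage_univ, measure_univ, mul_one]
    rw [← hDeq, ← ENNReal.ofReal_mul (inv_nonneg.2 hDpos.le), inv_mul_cancel₀ hDpos.ne',
      ENNReal.ofReal_one]
  have herg' := ergodic_pT hSsymm hmp hsymm hpos hind hPprob hPmeas hPcyl lam _ hL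
  exact main_aux hSsymm hSgen hPprob hPcyl lam _ hL herg'
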